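/- arXiv:2107.06385 — 2 statements merged into one kernel-verified Lean document; each statement's English description precedes it below -/
import Mathlib

section
/- Every automorphism φ ∈ Aut(P_λ) can be written as a product φ = α₁∘β₁∘α₂∘β₂∘⋯∘α_k∘β_k∘α_{k+1}∘c for some k ≥ 0, where α_i ∈ A₀ with α₂, …, α_k ≠ id, β_i ∈ B₀ with β₁, …, β_k ≠ id, and c ∈ C. -/
noncomputable section

open scoped Pointwise

variable (K : Type*) [Field K] [IsAlgClosed K] [CharZero K] (lam : K)

/-- `P_λ`: the quotient of `K[X,Y,Z]` by the ideal generated by `4XZ + Y² - λ`. -/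
abbrev PQ : Type _ :=
  MvPolynomial (Fin 3) K ⧸
    Ideal.span {4 * MvPolynomial.X 0 * MvPolynomial.X 2 + MvPolynomial.X 1 ^ 2 -
      MvPolynomial.C lam}

/-- `e`, the image of `X`. -/
def pe : PQ K lam := Ideal.Quotient.mk _ (MvPolynomial.X 0)

/-- `h`, the image of `Y`. -/
def ph : PQ K lam := Ideal.Quotient.mk _ (MvPolynomial.X 1)

/-- `f`, the image of `Z`. -/
def pf : PQ K lam := Ideal.Quotient.mk _ (MvPolynomial.X 2)

/-- A Poisson bracket on `P_λ`: a `K`-bilinear Lie bracket satisfying the Leibniz rule with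
`{e,f} = h`, `{h,e} = 2e`, `{h,f} = -2f`. -/
structure PoissonBr : Type _ where
  br : PQ K lam → PQ K lam → PQ K lam
  add_left : ∀ a b c, br (a + b) c = br a c + br b c
  add_right : ∀ a b c, br a (b + c) = br a b + br a c
  smul_left : ∀ (μ : K) (a b), br (μ • a) b = μ • br a b
  smul_right : ∀ (μ : K) (a b), br a (μ • b) = μ • br a b
  alternate : ∀ a, br a a = 0
  jacobi : ∀ a b c, br a (br b c) + br b (br c a) + br c (br a b) = 0
  leibniz : ∀ a b c, br a (b * c) = b * br a c + br a b * c
  br_ef : br (pe K lam) (pf K lam) = ph K lam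
  br_he : br (ph K lam) (pe K lam) = 2 * pe K lam
  br_hf : br (ph K lam) (pf K lam) = -2 * pf K lam

variable {K lam}

/-- `Aut(P_λ)`: the subgroup of `K`-algebra automorphisms of `P_λ` preserving the bracket.
Multiplication is composition: `(θ * φ) x = θ (φ x)`. -/
def PAut (B : PoissonBr K lam) : Subgroup ((PQ K lam) ≃ₐ[K] (PQ K lam)) where
  carrier := {φ | ∀ a b, φ (B.br a b) = B.br (φ a) (φ b)}
  one_mem' := fun _ _ => rfl
  mul_mem' := by
    intro φ ψ hφ hψ a b
    show φ (ψ (B.br a b)) = _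
    rw [hψ, hφ]
    rfl
  inv_mem' := by
    intro φ hφ a b
    apply φ.injective
    show φ (φ.symm (B.br a b)) = φ (B.br (φ.symm a) (φ.symm b))
    rw [hφ]
    simp

/-- `D` is the automorphism `Δ_g`:
`e ↦ e − g(f)h − f·g(f)²`, `h ↦ h + 2f·g(f)`, `f ↦ f`. -/
def IsDelta (B : PoissonBr K lam) (g : Polynomial K) (D : ↥(PAut B)) : Prop :=
  D.val (pe K lam) =
      pe K lam - Polynomial.aeval (pf K lam) g * ph K lam -
        pf K lam * Polynomial.aeval (pf K lam) g ^ 2 ∧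
  D.val (ph K lam) = ph K lam + 2 * (pf K lam * Polynomial.aeval (pf K lam) g) ∧
  D.val (pf K lam) = pf K lam

/-- `D` is the automorphism `τ`: `e ↦ f`, `h ↦ -h`, `f ↦ e`. -/
def IsTau (B : PoissonBr K lam) (D : ↥(PAut B)) : Prop :=
  D.val (pe K lam) = pf K lam ∧ D.val (ph K lam) = -ph K lam ∧ D.val (pf K lam) = pe K lam

/-- `D` is the automorphism `τ_α`: `e ↦ f`, `h ↦ -h + 2αf`, `f ↦ e + αh - α²f`. -/
def IsTauA (B : PoissonBr K lam) (α : K) (D : ↥(PAut B)) : Prop :=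
  D.val (pe K lam) = pf K lam ∧
  D.val (ph K lam) = -ph K lam + (2 * α) • pf K lam ∧
  D.val (pf K lam) = pe K lam + α • ph K lam - α ^ 2 • pf K lam

/-- `D` is the hyperbolic rotation `H_β`: `e ↦ βe`, `h ↦ h`, `f ↦ β⁻¹f`. -/
def IsHRot (B : PoissonBr K lam) (β : Kˣ) (D : ↥(PAut B)) : Prop :=
  D.val (pe K lam) = (β : K) • pe K lam ∧
  D.val (ph K lam) = ph K lam ∧
  D.val (pf K lam) = (β : K)⁻¹ • pf K lam

/-- The set `C` of linear triangular automorphisms: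
`e ↦ βe + αh − (α²/β)f`, `h ↦ h − (2α/β)f`, `f ↦ β⁻¹f` with `α ∈ K`, `β ∈ Kˣ`. -/
def CsetLT (B : PoissonBr K lam) : Set ↥(PAut B) :=
  {D | ∃ (α : K) (β : Kˣ),
    D.val (pe K lam) = (β : K) • pe K lam + α • ph K lam - (α ^ 2 / (β : K)) • pf K lam ∧
    D.val (ph K lam) = ph K lam - (2 * α / (β : K)) • pf K lam ∧
    D.val (pf K lam) = (β : K)⁻¹ • pf K lam}

set_option linter.unusedSectionVars false

section PolynomialLemmas

open Polynomial

lemma natDegree_X_mul_derivative_le {R : Type*} [CommRing R] (p : R[X]) :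
    (X * derivative p).natDegree ≤ p.natDegree := by
  rw [natDegree_le_iff_coeff_eq_zero]
  rintro (_ | n) hn
  · simp
  · rw [coeff_X_mul, coeff_derivative, coeff_eq_zero_of_natDegree_lt hn, zero_mul]

lemma coeff_X_mul_derivative {R : Type*} [CommRing R] (p : R[X]) (n : ℕ) :
    (X * derivative p).coeff n = n * p.coeff n := by
  rcases n with _ | n
  · simp
  · rw [coeff_X_mul, coeff_derivative]; push_cast; ring

lemma exists_eq_C_mul_of_derivative_mul_eq {k : Type*} [Field k] [CharZero k] {a b : k[X]}
    (ha : a ≠ 0) (h : derivative b * a = b * derivative a) : ∃ c, b = C c * a := by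
  have key (p : k[X]) (hp : p ≠ 0) (h : derivative p * a = p * derivative a) :
      p.natDegree = a.natDegree := by
    have h' : (X * derivative p) * a = p * (X * derivative a) := by linear_combination X * h
    have := congrArg (coeff · (p.natDegree + a.natDegree)) h'
    beta_reduce at this
    rw [coeff_mul_add_eq_of_natDegree_le (natDegree_X_mul_derivative_le p) le_rfl,
      coeff_mul_add_eq_of_natDegree_le le_rfl (natDegree_X_mul_derivative_le a),
      coeff_X_mul_derivative, coeff_X_mul_derivative, coeff_natDegree, coeff_natDegree] at this
    have hp' := leadingCoeff_ne_zero.mpr hp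
    have ha' := leadingCoeff_ne_zero.mpr ha
    have h2 : ((p.natDegree : k) - a.natDegree) * (p.leadingCoeff * a.leadingCoeff) = 0 := by
      linear_combination this
    have h3 := (mul_eq_zero.mp h2).resolve_right (mul_ne_zero hp' ha')
    exact_mod_cast sub_eq_zero.mp h3
  refine ⟨b.coeff a.natDegree / a.leadingCoeff, ?_⟩
  by_contra hne
  set c := b.coeff a.natDegree / a.leadingCoeff with hc
  have h0 : b - C c * a ≠ 0 := sub_ne_zero.mpr hne
  have hd := key _ h0 (by
    simp only [derivative_sub, derivative_C_mul]
    linear_combination h)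
  apply leadingCoeff_ne_zero.mpr h0
  rw [leadingCoeff, hd, coeff_sub, coeff_C_mul, coeff_natDegree, hc,
    div_mul_cancel₀ _ (leadingCoeff_ne_zero.mpr ha), sub_self]

lemma exists_eval_iterate_derivative_ne_zero {R : Type*} [CommRing R] [IsDomain R] [CharZero R]
    {p : R[X]} (hp : p ≠ 0) {ζ κ β : R} (hζ : ζ ≠ 1) (hζ0 : ζ ≠ 0) (hβ : β ≠ 0)
    (h : p.comp (C ζ * X) = C κ * p) :
    ∃ t, 2 * t ≤ p.natDegree ∧ (derivative^[t] p).eval β ≠ 0 := by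
  classical
  by_contra! hcon
  have hder (i : ℕ) : derivative^[i] (p.comp (C ζ * X)) =
      C (ζ ^ i) * (derivative^[i] p).comp (C ζ * X) := by
    induction i with
    | zero => simp
    | succ i ih =>
      rw [Function.iterate_succ_apply', ih, Function.iterate_succ_apply']
      simp only [derivative_C_mul, derivative_comp, derivative_X, mul_one, pow_succ, C_mul]
      ring
  have hroot (m : ℕ) (hm : m ≤ p.natDegree / 2) : (derivative^[m] p).IsRoot β :=
    hcon m (by omega)
  have hroot' (m : ℕ) (hm : m ≤ p.natDegree / 2) : (derivative^[m] p).IsRoot (ζ * β) := by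
    have h1 := congrArg (eval β) (hder m)
    rw [h, iterate_derivative_C_mul, eval_mul, (hroot m hm).eq_zero] at h1
    simp only [mul_zero, eval_mul, eval_C, eval_comp, eval_X] at h1
    exact (mul_eq_zero.mp h1.symm).resolve_left (pow_ne_zero _ hζ0)
  have h1 := lt_rootMultiplicity_of_isRoot_iterate_derivative hp hroot
  have h2 := lt_rootMultiplicity_of_isRoot_iterate_derivative hp hroot'
  have hne : β ≠ ζ * β := fun h => hζ (mul_right_cancel₀ hβ (by rw [one_mul, ← h]))
  have h3 : p.roots.count β + p.roots.count (ζ * β) ≤ p.natDegree := by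
    refine le_trans ?_ (card_roots' p)
    rw [← Multiset.toFinset_sum_count_eq, ← Finset.sum_pair (f := fun x => p.roots.count x) hne]
    refine Finset.sum_le_sum_of_subset ?_
    intro x hx
    rw [Multiset.mem_toFinset, ← Multiset.count_pos, count_roots]
    rcases Finset.mem_insert.mp hx with rfl | hx
    · omega
    · rw [Finset.mem_singleton.mp hx]; omega
  rw [count_roots, count_roots] at h3
  omega

variable {k : Type*} [Field k]

/-- The derivation `∂/∂y` of `k[y][f]`, acting on coefficients. -/
def coeffDeriv : Derivation k k[X][X] k[X][X] :=
  (PolynomialModule.equivPolynomialSelf (R := k[X])).toLinearMap.compDer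
    (derivative' (R := k)).mapCoeffs

@[simp]
lemma coeffDeriv_coeff (p : k[X][X]) (i : ℕ) :
    (coeffDeriv p).coeff i = derivative (p.coeff i) := rfl

@[simp]
lemma coeffDeriv_X : coeffDeriv (X : k[X][X]) = 0 := by
  ext1 i
  rw [coeffDeriv_coeff, coeff_X]
  split_ifs <;> simp

@[simp]
lemma coeffDeriv_C (p : k[X]) : coeffDeriv (C p) = C (derivative p) := by
  ext1 i
  rw [coeffDeriv_coeff, coeff_C, coeff_C]
  split_ifs <;> simp

/-- The derivation `{a, ·}` of `k[y][f]` for the Poisson bracket with `{y, f} = 2`. -/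
def polyBr (a : k[X][X]) : Derivation k k[X][X] k[X][X] :=
  (2 * coeffDeriv a) • (derivative' (R := k[X])).restrictScalars k -
    (2 * derivative a) • coeffDeriv

lemma polyBr_apply (a b : k[X][X]) :
    polyBr a b = 2 * (coeffDeriv a * derivative b - derivative a * coeffDeriv b) := by
  simp only [polyBr, Derivation.sub_apply, Derivation.smul_apply, smul_eq_mul,
    Derivation.restrictScalars_apply, derivative'_apply]
  ring

lemma polyBr_self (a : k[X][X]) : polyBr a a = 0 := by
  rw [polyBr_apply]; ring

lemma polyBr_swap (a b : k[X][X]) : polyBr a b = -polyBr b a := by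
  rw [polyBr_apply, polyBr_apply]; ring

lemma natDegree_coeffDeriv_le (a : k[X][X]) : (coeffDeriv a).natDegree ≤ a.natDegree := by
  rw [natDegree_le_iff_coeff_eq_zero]
  intro n hn
  rw [coeffDeriv_coeff, coeff_eq_zero_of_natDegree_lt hn, derivative_zero]

lemma X_mul_polyBr (a b : k[X][X]) :
    X * polyBr a b = C 2 * (coeffDeriv a * (X * derivative b)) -
      C 2 * ((X * derivative a) * coeffDeriv b) := by
  rw [polyBr_apply, show (C 2 : k[X][X]) = 2 from rfl]; ring

lemma coeff_X_mul_polyBr {a b : k[X][X]} {m n : ℕ} (ha : a.natDegree ≤ m) (hb : b.natDegree ≤ n) :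
    (X * polyBr a b).coeff (m + n) =
      2 * (n * derivative (a.coeff m) * b.coeff n - m * a.coeff m * derivative (b.coeff n)) := by
  rw [X_mul_polyBr, coeff_sub, coeff_C_mul, coeff_C_mul,
    coeff_mul_add_eq_of_natDegree_le ((natDegree_coeffDeriv_le a).trans ha)
      ((natDegree_X_mul_derivative_le b).trans hb),
    coeff_mul_add_eq_of_natDegree_le ((natDegree_X_mul_derivative_le a).trans ha)
      ((natDegree_coeffDeriv_le b).trans hb), coeff_X_mul_derivative, coeff_X_mul_derivative,
    coeffDeriv_coeff, coeffDeriv_coeff]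
  ring

lemma natDegree_polyBr_lt {a b : k[X][X]} (h : polyBr a b ≠ 0) :
    (polyBr a b).natDegree + 1 ≤ a.natDegree + b.natDegree := by
  rw [← natDegree_X_mul h, X_mul_polyBr]
  refine (natDegree_sub_le _ _).trans (max_le ?_ ?_) <;>
    refine (natDegree_C_mul_le _ _).trans (natDegree_mul_le_of_le ?_ ?_)
  exacts [natDegree_coeffDeriv_le _, natDegree_X_mul_derivative_le _,
    natDegree_X_mul_derivative_le _, natDegree_coeffDeriv_le _]

lemma natDegree_add_le_of_polyBr_step {G : ℕ → k[X][X]} {F : k[X][X]}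
    [CharZero k] (hF : F ≠ 0) (hG : ∀ t, polyBr F (G t) = 2 * F * G (t + 1)) (t : ℕ)
    (ht : G t ≠ 0) :
    (G t).natDegree + t ≤ (G 0).natDegree := by
  induction t with
  | zero => simp
  | succ t ih =>
    have h2 : (2 : k[X][X]) * F ≠ 0 := mul_ne_zero two_ne_zero hF
    have hne : polyBr F (G t) ≠ 0 := by
      rw [hG]; exact mul_ne_zero h2 ht
    have h1 := natDegree_polyBr_lt hne
    have h0 : G t ≠ 0 := by
      rintro h0
      exact hne (by rw [h0, map_zero])
    have h3 : (2 : k[X][X]).natDegree = 0 := natDegree_ofNat 2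
    rw [hG, natDegree_mul h2 ht, natDegree_mul two_ne_zero hF, h3] at h1
    have := ih h0
    omega

/-- A lower bound for the degree of a polynomial expression in `F` and `H` with `{F, H} = 2F`
when the degree of `F` does not divide that of `H`. -/
lemma exists_natDegree_sum_ge [IsAlgClosed k] [CharZero k] {F H : k[X][X]} {m q : ℕ}
    (hm : F.natDegree = m) (hq : H.natDegree = q) (hm0 : m ≠ 0) (hmq : ¬ m ∣ q)
    (hFH : polyBr F H = 2 * F) {s : Finset (ℕ × ℕ)} {c : ℕ × ℕ → k} (hc : ∀ x ∈ s, c x ≠ 0)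
    {d : ℕ} (hd : ∃ x ∈ s, x.2 = d) (hd' : ∀ x ∈ s, x.2 ≤ d) :
    ∃ t, 2 * t ≤ d ∧
      d * q + t ≤ (∑ x ∈ s, c x • (F ^ x.1 * H ^ x.2)).natDegree + t * q := by
  classical
  have hF : F ≠ 0 := by rintro rfl; simp at hm; omega
  have hH : H ≠ 0 := by rintro rfl; simp at hq; subst hq; simp at hmq
  set α := F.coeff m with hα
  set β := H.coeff q with hβ
  have hα0 : α ≠ 0 := by rw [hα, ← hm]; exact leadingCoeff_ne_zero.mpr hF
  have hβ0 : β ≠ 0 := by rw [hβ, ← hq]; exact leadingCoeff_ne_zero.mpr hH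
  have : NeZero (m : k) := ⟨by exact_mod_cast hm0⟩
  have : NeZero m := ⟨hm0⟩
  obtain ⟨ω, hω⟩ := HasEnoughRootsOfUnity.exists_primitiveRoot k m
  have hω0 : ω ≠ 0 := hω.ne_zero hm0
  obtain ⟨x₀, hx₀, hx₀'⟩ := Finset.exists_mem_eq_sup s (hd.imp fun x h => h.1)
    (fun x => m * x.1 + q * x.2)
  set N := s.sup (fun x => m * x.1 + q * x.2) with hN
  have hNle (x) (hx : x ∈ s) : m * x.1 + q * x.2 ≤ N :=
    Finset.le_sup (f := fun x : ℕ × ℕ => m * x.1 + q * x.2) hx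
  have hNd : d * q ≤ N := by
    obtain ⟨x, hx, rfl⟩ := hd
    have := hNle x hx
    rw [mul_comm]; omega
  set γ : k[X][X] := ∑ x ∈ s.filter (fun x => m * x.1 + q * x.2 = N),
    C (C (c x) * α ^ x.1) * X ^ x.2 with hγ
  have hγ0 : γ ≠ 0 := by
    intro h0
    have h1 : γ.coeff x₀.2 = C (c x₀) * α ^ x₀.1 := by
      rw [hγ, finsetSum_coeff, Finset.sum_eq_single x₀]
      · rw [coeff_C_mul, coeff_X_pow, if_pos rfl, mul_one]
      · intro x hx hne
        rw [Finset.mem_filter] at hx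
        rw [coeff_C_mul, coeff_X_pow, if_neg, mul_zero]
        intro h2
        apply hne
        have h3 : m * x.1 = m * x₀.1 := by
          have := hx.2
          rw [hx₀', ← h2] at this
          omega
        exact Prod.ext (Nat.eq_of_mul_eq_mul_left (by omega) h3) h2.symm
      · intro h2
        exact absurd (Finset.mem_filter.mpr ⟨hx₀, hx₀'.symm⟩) h2
    rw [h0, coeff_zero] at h1
    exact mul_ne_zero (C_ne_zero.mpr (hc _ hx₀)) (pow_ne_zero _ hα0) h1.symm
  have hγd : γ.natDegree ≤ d := by
    refine natDegree_sum_le_of_forall_le _ _ fun x hx => ?_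
    exact (natDegree_C_mul_X_pow_le _ _).trans (hd' x (Finset.mem_filter.mp hx).1)
  have hcomp : γ.comp (C (C (ω ^ q)) * X) = C (C (ω ^ N)) * γ := by
    rw [hγ, sum_comp, Finset.mul_sum]
    refine Finset.sum_congr rfl fun x hx => ?_
    have h1 : ω ^ N = (ω ^ q) ^ x.2 := by
      rw [← (Finset.mem_filter.mp hx).2, pow_add, pow_mul, hω.pow_eq_one, one_pow, one_mul, pow_mul]
    rw [h1]
    simp only [mul_comp, C_comp, pow_comp, X_comp, C_pow, mul_pow]
    ring
  obtain ⟨t, ht, hne⟩ := exists_eval_iterate_derivative_ne_zero hγ0 (ζ := C (ω ^ q)) (β := β)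
    (by
      intro h
      rw [← C_1, C_inj, hω.pow_eq_one_iff_dvd] at h
      exact hmq h)
    (C_ne_zero.mpr (pow_ne_zero _ hω0)) hβ0 hcomp
  refine ⟨t, ht.trans hγd, ?_⟩
  set G : ℕ → k[X][X] := fun t => ∑ x ∈ s,
    (c x * (x.2.descFactorial t : k)) • (F ^ x.1 * H ^ (x.2 - t)) with hG
  have hstep (t) : polyBr F (G t) = 2 * F * G (t + 1) := by
    rw [hG]
    simp only [map_sum, Finset.mul_sum]
    refine Finset.sum_congr rfl fun x _ => ?_
    rw [Derivation.map_smul, Derivation.leibniz, Derivation.leibniz_pow, Derivation.leibniz_pow,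
      polyBr_self, hFH, Nat.descFactorial_succ]
    simp only [smul_eq_mul, mul_zero, add_zero, Algebra.smul_def, map_mul, map_natCast,
      eq_natCast, Nat.cast_mul]
    rw [show x.2 - (t + 1) = x.2 - t - 1 by omega]
    ring
  have htN : t * q ≤ N := (Nat.mul_le_mul_right q (by omega)).trans hNd
  have hcoeff : (G t).coeff (N - t * q) = (derivative^[t] γ).eval β := by
    rw [hG, hγ, iterate_derivative_sum, eval_finsetSum, finsetSum_coeff, Finset.sum_filter]
    refine Finset.sum_congr rfl fun x hx => ?_
    rw [iterate_derivative_C_mul, iterate_derivative_X_pow_eq_natCast_mul]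
    rcases lt_or_ge x.2 t with hlt | hge
    · simp [Nat.descFactorial_eq_zero_iff_lt.mpr hlt]
    have hle := hNle x hx
    obtain ⟨r, hr⟩ := Nat.exists_eq_add_of_le hge
    have hdeg : (F ^ x.1 * H ^ (x.2 - t)).natDegree = m * x.1 + q * x.2 - t * q := by
      rw [natDegree_mul (pow_ne_zero _ hF) (pow_ne_zero _ hH), natDegree_pow, natDegree_pow, hm, hq,
        hr, Nat.add_sub_cancel_left, Nat.mul_add, ← Nat.add_assoc]
      rw [mul_comm x.1, mul_comm r, mul_comm t]
      omega
    have hsub : t * q ≤ q * x.2 := by rw [mul_comm]; exact Nat.mul_le_mul_left q hge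
    rw [coeff_smul]
    split_ifs with heq
    · rw [← heq, ← hdeg, coeff_natDegree, leadingCoeff_mul, leadingCoeff_pow, leadingCoeff_pow,
        leadingCoeff, leadingCoeff, hm, hq, ← hα, ← hβ]
      simp [Algebra.smul_def]
      ring
    · rw [coeff_eq_zero_of_natDegree_lt (by omega), smul_zero]
  have hGt : G t ≠ 0 := by
    intro h0
    rw [h0, coeff_zero] at hcoeff
    exact hne hcoeff.symm
  have h1 : N - t * q ≤ (G t).natDegree := le_natDegree_of_ne_zero (by rwa [hcoeff])
  have h2 := natDegree_add_le_of_polyBr_step hF hstep t hGt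
  have h3 : G 0 = ∑ x ∈ s, c x • (F ^ x.1 * H ^ x.2) := by simp [hG]
  rw [h3] at h2
  omega

end PolynomialLemmas

section Model

open Polynomial

lemma rel_eq : 4 * pe K lam * pf K lam + ph K lam ^ 2 = algebraMap K (PQ K lam) lam := by
  rw [← sub_eq_zero]
  exact Ideal.Quotient.eq_zero_iff_mem.mpr (Ideal.subset_span rfl)

lemma PQ.induction {p : PQ K lam → Prop} (hC : ∀ r, p (algebraMap K (PQ K lam) r))
    (hadd : ∀ a b, p a → p b → p (a + b)) (he : ∀ a, p a → p (a * pe K lam))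
    (hh : ∀ a, p a → p (a * ph K lam)) (hf : ∀ a, p a → p (a * pf K lam)) (a : PQ K lam) : p a := by
  obtain ⟨a, rfl⟩ := Ideal.Quotient.mk_surjective a
  induction a using MvPolynomial.induction_on with
  | C r => exact hC r
  | add a b ha hb => rw [map_add]; exact hadd _ _ ha hb
  | mul_X a i ha =>
    rw [map_mul]
    fin_cases i
    exacts [he _ ha, hh _ ha, hf _ ha]

/-- A chosen square root of `lam`. -/
def rootLam (lam : K) : K := (IsAlgClosed.exists_pow_nat_eq lam two_pos).choose

lemma rootLam_sq (lam : K) : rootLam lam ^ 2 = lam :=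
  (IsAlgClosed.exists_pow_nat_eq lam two_pos).choose_spec

/-- The embedding of `P_λ` into `K[y][f]` with `h = μ - f y` and `e = y (2 μ - f y) / 4`, where
`μ² = λ`. The degree in `f` is the total degree in `e, h, f`. -/
def toPoly : PQ K lam →ₐ[K] K[X][X] :=
  Ideal.Quotient.liftₐ _ (MvPolynomial.aeval
    ![C (C (1 / 4) * X) * (C (C (2 * rootLam lam)) - C X * X), C (C (rootLam lam)) - C X * X,
        X]) (by
    intro a ha
    rw [← RingHom.mem_ker]
    refine (Ideal.span_le (I := RingHom.ker _)).mpr ?_ ha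
    rintro _ rfl
    rw [SetLike.mem_coe, RingHom.mem_ker]
    have h1 : (C (C lam) : K[X][X]) = C (C (rootLam lam)) ^ 2 := by
      rw [← C_pow, ← C_pow, rootLam_sq]
    have h2 : (4 : K[X][X]) * C (C (1 / 4)) = 1 := by
      have : (4 : K[X][X]) = C (C 4) := rfl
      rw [this, ← C_mul, ← C_mul]; norm_num
    simp only [map_sub, map_add, map_mul, map_pow, MvPolynomial.aeval_X, map_ofNat,
      MvPolynomial.aeval_C, Matrix.cons_val_zero, Matrix.cons_val_one, Matrix.cons_val]
    rw [show algebraMap K K[X][X] lam = C (C lam) from rfl, h1]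
    linear_combination (C X * (2 * C (C (rootLam lam)) - C X * X) * X) * h2)

lemma toPoly_pe : toPoly (pe K lam) =
    C (C (1 / 4) * X) * (C (C (2 * rootLam lam)) - C X * X) := by
  refine (Ideal.Quotient.lift_mk _ _ _).trans ?_
  simp

lemma toPoly_ph : toPoly (ph K lam) = C (C (rootLam lam)) - C X * X := by
  refine (Ideal.Quotient.lift_mk _ _ _).trans ?_
  simp

lemma toPoly_pf : toPoly (pf K lam) = X := by
  refine (Ideal.Quotient.lift_mk _ _ _).trans ?_
  simp

lemma PoissonBr.br_swap (B : PoissonBr K lam) (a b : PQ K lam) : B.br a b = -B.br b a := by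
  have h := B.alternate (a + b)
  rw [B.add_left, B.add_right, B.add_right, B.alternate, B.alternate, zero_add, add_zero] at h
  exact eq_neg_of_add_eq_zero_left h

lemma PoissonBr.br_algebraMap (B : PoissonBr K lam) (a : PQ K lam) (r : K) :
    B.br a (algebraMap K _ r) = 0 := by
  have h := B.leibniz a 1 1
  rw [one_mul, one_mul, mul_one] at h
  rw [Algebra.algebraMap_eq_smul_one, B.smul_right, left_eq_add.mp h, smul_zero]

lemma toPoly_br_of_gens (B : PoissonBr K lam) (a : PQ K lam)
    (he : toPoly (B.br a (pe K lam)) = polyBr (toPoly a) (toPoly (pe K lam)))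
    (hh : toPoly (B.br a (ph K lam)) = polyBr (toPoly a) (toPoly (ph K lam)))
    (hf : toPoly (B.br a (pf K lam)) = polyBr (toPoly a) (toPoly (pf K lam))) (b : PQ K lam) :
    toPoly (B.br a b) = polyBr (toPoly a) (toPoly b) := by
  have hmul (g : PQ K lam) (hg : toPoly (B.br a g) = polyBr (toPoly a) (toPoly g)) (b : PQ K lam)
      (hb : toPoly (B.br a b) = polyBr (toPoly a) (toPoly b)) :
      toPoly (B.br a (b * g)) = polyBr (toPoly a) (toPoly (b * g)) := by
    rw [B.leibniz, map_add, map_mul, map_mul, map_mul, Derivation.leibniz, hg, hb, smul_eq_mul,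
      smul_eq_mul]
    ring
  induction b using PQ.induction with
  | hC r =>
    rw [B.br_algebraMap, map_zero, AlgHom.commutes, Derivation.map_algebraMap]
  | hadd b c hb hc => rw [B.add_right, map_add, map_add, map_add, hb, hc]
  | he b hb => exact hmul _ he b hb
  | hh b hb => exact hmul _ hh b hb
  | hf b hb => exact hmul _ hf b hb

lemma toPoly_br (B : PoissonBr K lam) (a b : PQ K lam) :
    toPoly (B.br a b) = polyBr (toPoly a) (toPoly b) := by
  have swap (a b : PQ K lam) (h : toPoly (B.br a b) = polyBr (toPoly a) (toPoly b)) :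
      toPoly (B.br b a) = polyBr (toPoly b) (toPoly a) := by
    rw [B.br_swap, map_neg, h, polyBr_swap (toPoly b)]
  have self (a : PQ K lam) : toPoly (B.br a a) = polyBr (toPoly a) (toPoly a) := by
    rw [B.alternate, map_zero, polyBr_self]
  have h4 : (4 : K[X][X]) * C (C 4⁻¹) = 1 := by
    have : (4 : K[X][X]) = C (C 4) := rfl
    rw [this, ← C_mul, ← C_mul]; norm_num
  have h2 : (C (C 2) : K[X][X]) = 2 := rfl
  have hef : toPoly (B.br (pe K lam) (pf K lam)) =
      polyBr (toPoly (pe K lam)) (toPoly (pf K lam)) := by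
    rw [B.br_ef, toPoly_pe, toPoly_ph, toPoly_pf, polyBr_apply]
    simp
    rw [h2]
    linear_combination (C X * X - C (C (rootLam lam))) * h4
  have hhe : toPoly (B.br (ph K lam) (pe K lam)) =
      polyBr (toPoly (ph K lam)) (toPoly (pe K lam)) := by
    rw [B.br_he, map_mul, map_ofNat, toPoly_pe, toPoly_ph, polyBr_apply]
    simp
    ring
  have hhf : toPoly (B.br (ph K lam) (pf K lam)) =
      polyBr (toPoly (ph K lam)) (toPoly (pf K lam)) := by
    rw [B.br_hf, map_mul, map_neg, map_ofNat, toPoly_ph, toPoly_pf, polyBr_apply]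
    simp
    ring
  have he := toPoly_br_of_gens B (pe K lam) (self _) (swap _ _ hhe) hef
  have hh := toPoly_br_of_gens B (ph K lam) hhe (self _) hhf
  have hf := toPoly_br_of_gens B (pf K lam) (swap _ _ hef) (swap _ _ hhf) (self _)
  exact toPoly_br_of_gens B a (swap _ _ (he a)) (swap _ _ (hh a)) (swap _ _ (hf a)) b

end Model

section Filtration

open Polynomial

variable {R : Type*} [CommRing R] [Algebra K R] (e h f : R)

/-- The standard monomials of degree `n`: `h ^ l * f ^ (n - l)` for `l ≤ n`, and
`e ^ (l - n) * h ^ (2 * n - l)` for `n ≤ l ≤ 2 * n`. -/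
def stdMonomial (n l : ℕ) : R :=
  if l ≤ n then h ^ l * f ^ (n - l) else e ^ (l - n) * h ^ (2 * n - l)

lemma stdMonomial_add_left (n i : ℕ) : stdMonomial e h f (n + i) n = h ^ n * f ^ i := by
  rw [stdMonomial, if_pos (Nat.le_add_right _ _), Nat.add_sub_cancel_left]

lemma stdMonomial_add_two_mul (n i : ℕ) :
    stdMonomial e h f (n + i) (n + 2 * i) = e ^ i * h ^ n := by
  rcases Nat.eq_zero_or_pos i with rfl | hi
  · simp [stdMonomial]
  · rw [stdMonomial, if_neg (by omega), show n + 2 * i - (n + i) = i by omega,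
      show 2 * (n + i) - (n + 2 * i) = n by omega]

variable (K) in
/-- The span of the standard monomials of degree less than `N`. -/
def stdFiltration : ℕ → Submodule K R
  | 0 => ⊥
  | N + 1 => stdFiltration N ⊔
      Submodule.span K (Set.range fun l : Fin (2 * N + 1) => stdMonomial e h f N l)

variable {e h f}

lemma stdFiltration_mono : Monotone (stdFiltration K e h f) :=
  monotone_nat_of_le_succ fun _ => le_sup_left

lemma stdMonomial_mem {n l N : ℕ} (hn : n < N) (hl : l ≤ 2 * n) :
    stdMonomial e h f n l ∈ stdFiltration K e h f N :=
  stdFiltration_mono hn (Submodule.mem_sup_right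
    (Submodule.subset_span ⟨⟨l, Nat.lt_succ_of_le hl⟩, rfl⟩))

lemma pow_mul_pow_mem {n i N : ℕ} (hN : n + i < N) : h ^ n * f ^ i ∈ stdFiltration K e h f N := by
  rw [← stdMonomial_add_left e]; exact stdMonomial_mem hN (by omega)

lemma pow_mul_pow_mem' {n i N : ℕ} (hN : n + i < N) : e ^ i * h ^ n ∈ stdFiltration K e h f N := by
  rw [← stdMonomial_add_two_mul e h f]; exact stdMonomial_mem hN (by omega)

lemma stdFiltration_le {N : ℕ} {S : Submodule K R} (hf : ∀ n i, n + i < N → h ^ n * f ^ i ∈ S)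
    (he : ∀ n i, n + i < N → e ^ i * h ^ n ∈ S) : stdFiltration K e h f N ≤ S := by
  have key (M : ℕ) : M ≤ N → stdFiltration K e h f M ≤ S := by
    induction M with
    | zero => intro; exact bot_le
    | succ M ih =>
      intro hM
      refine sup_le (ih (by omega)) (Submodule.span_le.mpr ?_)
      rintro _ ⟨⟨l, hl⟩, rfl⟩
      rcases le_total l M with hlM | hlM
      · obtain ⟨i, rfl⟩ := Nat.exists_eq_add_of_le hlM
        dsimp only
        rw [stdMonomial_add_left]
        exact hf _ _ (by omega)
      · obtain ⟨i, rfl⟩ := Nat.exists_eq_add_of_le hlM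
        obtain ⟨n, rfl⟩ := Nat.exists_eq_add_of_le' (show i ≤ M by omega)
        dsimp only
        rw [add_assoc, ← two_mul, stdMonomial_add_two_mul]
        exact he _ _ (by omega)
  exact key N le_rfl

lemma mul_mem_stdFiltration {N : ℕ} {g : R}
    (hf : ∀ n i, n + i < N → h ^ n * f ^ i * g ∈ stdFiltration K e h f (N + 1))
    (he : ∀ n i, n + i < N → e ^ i * h ^ n * g ∈ stdFiltration K e h f (N + 1))
    {a : R} (ha : a ∈ stdFiltration K e h f N) : a * g ∈ stdFiltration K e h f (N + 1) :=
  stdFiltration_le (S := (stdFiltration K e h f (N + 1)).comap (LinearMap.mulRight K g)) hf he ha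

lemma mul_right_mem_of_rel (hef : 4 * e * f + h ^ 2 = algebraMap K R lam) {N : ℕ} {a : R}
    (ha : a ∈ stdFiltration K e h f N) :
    a * e ∈ stdFiltration K e h f (N + 1) ∧ a * h ∈ stdFiltration K e h f (N + 1) ∧
      a * f ∈ stdFiltration K e h f (N + 1) := by
  have hef' : e * f = (4⁻¹ * lam) • (1 : R) - (4⁻¹ : K) • h ^ 2 := by
    have h4 : (4 : R) * algebraMap K _ 4⁻¹ = 1 := by
      rw [← map_ofNat (algebraMap K R) 4, ← map_mul]; simp
    rw [Algebra.smul_def, Algebra.smul_def, map_mul]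
    linear_combination (algebraMap K R 4⁻¹) * hef - e * f * h4
  refine ⟨?_, ?_, ?_⟩
  · refine mul_mem_stdFiltration (fun n i hN => ?_) (fun n i hN => ?_) ha
    · cases i with
      | zero =>
        rw [pow_zero, mul_one, mul_comm]
        simpa using pow_mul_pow_mem' (e := e) (n := n) (i := 1) (by omega)
      | succ i =>
        rw [pow_succ, mul_assoc, mul_assoc, mul_comm f, hef', mul_sub, mul_sub,
          mul_smul_comm, mul_smul_comm, mul_smul_comm, mul_smul_comm, mul_one,
          mul_comm (f ^ i), ← mul_assoc, ← pow_add]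
        exact sub_mem (Submodule.smul_mem _ _ (pow_mul_pow_mem (by omega)))
          (Submodule.smul_mem _ _ (pow_mul_pow_mem (by omega)))
    · rw [mul_right_comm, ← pow_succ]; exact pow_mul_pow_mem' (by omega)
  · refine mul_mem_stdFiltration (fun n i hN => ?_) (fun n i hN => ?_) ha
    · rw [mul_right_comm, ← pow_succ]; exact pow_mul_pow_mem (by omega)
    · rw [mul_assoc, ← pow_succ]; exact pow_mul_pow_mem' (by omega)
  · refine mul_mem_stdFiltration (fun n i hN => ?_) (fun n i hN => ?_) ha
    · rw [mul_assoc, ← pow_succ]; exact pow_mul_pow_mem (by omega)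
    · cases i with
      | zero =>
        rw [pow_zero, one_mul]
        simpa using pow_mul_pow_mem (f := f) (n := n) (i := 1) (by omega)
      | succ i =>
        rw [pow_succ, mul_right_comm, mul_assoc (e ^ i), hef', mul_sub, sub_mul,
          mul_smul_comm, mul_smul_comm, smul_mul_assoc, smul_mul_assoc, mul_one, mul_assoc,
          ← pow_add]
        exact sub_mem (Submodule.smul_mem _ _ (pow_mul_pow_mem' (by omega)))
          (Submodule.smul_mem _ _ (pow_mul_pow_mem' (by omega)))

lemma exists_mem_stdFiltration (a : PQ K lam) :
    ∃ N, a ∈ stdFiltration K (pe K lam) (ph K lam) (pf K lam) N := by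
  induction a using PQ.induction with
  | hC r =>
    refine ⟨1, ?_⟩
    rw [Algebra.algebraMap_eq_smul_one]
    refine Submodule.smul_mem _ _ ?_
    simpa using pow_mul_pow_mem (e := pe K lam) (h := ph K lam) (f := pf K lam)
      (n := 0) (i := 0) one_pos
  | hadd a b ha hb =>
    obtain ⟨N, hN⟩ := ha
    obtain ⟨M, hM⟩ := hb
    exact ⟨max N M, add_mem (stdFiltration_mono (le_max_left _ _) hN)
      (stdFiltration_mono (le_max_right _ _) hM)⟩
  | he a ha => exact ha.imp' _ fun N hN => (mul_right_mem_of_rel rel_eq hN).1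
  | hh a ha => exact ha.imp' _ fun N hN => (mul_right_mem_of_rel rel_eq hN).2.1
  | hf a ha => exact ha.imp' _ fun N hN => (mul_right_mem_of_rel rel_eq hN).2.2

lemma natDegree_toPoly_ph_le : (toPoly (ph K lam)).natDegree ≤ 1 := by
  rw [toPoly_ph]; compute_degree

lemma natDegree_toPoly_pe_le : (toPoly (pe K lam)).natDegree ≤ 1 := by
  rw [toPoly_pe]; compute_degree

lemma coeff_toPoly_ph : (toPoly (ph K lam)).coeff 1 = C (-1) * X := by
  rw [toPoly_ph]; simp [coeff_C]

lemma coeff_toPoly_pe : (toPoly (pe K lam)).coeff 1 = C (-1 / 4) * X ^ 2 := by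
  rw [toPoly_pe, coeff_C_mul, show (-1 / 4 : K) = -(1 / 4) by ring, C_neg]
  simp only [coeff_sub, coeff_C_mul, coeff_X_one, coeff_C_succ]
  ring

lemma coeff_toPoly_stdMonomial {n l : ℕ} (hl : l ≤ 2 * n) :
    ∃ κ : K, κ ≠ 0 ∧
      (toPoly (stdMonomial (pe K lam) (ph K lam) (pf K lam) n l)).coeff n = C κ * X ^ l := by
  have h1 := natDegree_toPoly_pe_le (lam := lam)
  have h2 := natDegree_toPoly_ph_le (lam := lam)
  have h3 : (toPoly (pf K lam)).natDegree ≤ 1 := by rw [toPoly_pf]; exact natDegree_X_le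
  have pow_coeff {p : K[X][X]} (hp : p.natDegree ≤ 1) (i : ℕ) : (p ^ i).coeff i =
      p.coeff 1 ^ i := by
    simpa using coeff_pow_of_natDegree_le (m := i) hp
  have pow_deg {p : K[X][X]} (hp : p.natDegree ≤ 1) (i : ℕ) : (p ^ i).natDegree ≤ i := by
    simpa using natDegree_pow_le_of_le i hp
  rcases le_total l n with h | h
  · obtain ⟨i, rfl⟩ := Nat.exists_eq_add_of_le h
    rw [stdMonomial_add_left, map_mul, map_pow, map_pow]
    refine ⟨(-1) ^ l, pow_ne_zero _ (by simp), ?_⟩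
    rw [coeff_mul_add_eq_of_natDegree_le (pow_deg h2 _) (pow_deg h3 _), pow_coeff h2,
      pow_coeff h3, coeff_toPoly_ph, toPoly_pf, coeff_X_one, one_pow, mul_one, mul_pow, C_pow]
  · obtain ⟨i, rfl⟩ := Nat.exists_eq_add_of_le h
    obtain ⟨n, rfl⟩ := Nat.exists_eq_add_of_le' (show i ≤ n by omega)
    rw [add_assoc, ← two_mul, stdMonomial_add_two_mul, map_mul, map_pow, map_pow, add_comm n i]
    refine ⟨(-1 / 4) ^ i * (-1) ^ n,
      mul_ne_zero (pow_ne_zero _ (by norm_num)) (pow_ne_zero _ (by simp)), ?_⟩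
    rw [coeff_mul_add_eq_of_natDegree_le (pow_deg h1 _) (pow_deg h2 _), pow_coeff h1,
      pow_coeff h2, coeff_toPoly_ph, coeff_toPoly_pe, C_mul, C_pow, C_pow, mul_pow, mul_pow]
    ring

variable (K lam) in
/-- The elements of `P_λ` of degree less than `N` in `e, h, f`. -/
abbrev filt (N : ℕ) : Submodule K (PQ K lam) :=
  stdFiltration K (pe K lam) (ph K lam) (pf K lam) N

lemma coeff_toPoly_of_mem_filt {N n : ℕ} (hn : N ≤ n) {a : PQ K lam} (ha : a ∈ filt K lam N) :
    (toPoly a).coeff n = 0 := by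
  have pow_deg {p : K[X][X]} (hp : p.natDegree ≤ 1) (i : ℕ) : (p ^ i).natDegree ≤ i := by
    simpa using natDegree_pow_le_of_le i hp
  have h1 := natDegree_toPoly_pe_le (lam := lam)
  have h2 := natDegree_toPoly_ph_le (lam := lam)
  have h3 : (toPoly (pf K lam)).natDegree ≤ 1 := by rw [toPoly_pf]; exact natDegree_X_le
  refine stdFiltration_le (S := LinearMap.ker (((lcoeff K[X] n).restrictScalars K).comp
    (toPoly (lam := lam)).toLinearMap)) (fun j i hN => ?_) (fun j i hN => ?_) ha
  · refine LinearMap.mem_ker.mpr (coeff_eq_zero_of_natDegree_lt ?_)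
    change (toPoly (ph K lam ^ j * pf K lam ^ i)).natDegree < n
    rw [map_mul, map_pow, map_pow]
    exact (natDegree_mul_le.trans (add_le_add (pow_deg h2 _) (pow_deg h3 _))).trans_lt (by omega)
  · refine LinearMap.mem_ker.mpr (coeff_eq_zero_of_natDegree_lt ?_)
    change (toPoly (pe K lam ^ i * ph K lam ^ j)).natDegree < n
    rw [map_mul, map_pow, map_pow]
    exact (natDegree_mul_le.trans (add_le_add (pow_deg h1 _) (pow_deg h2 _))).trans_lt (by omega)

lemma mem_filt_of_coeff_eq_zero {N : ℕ} {a : PQ K lam} (ha : a ∈ filt K lam (N + 1))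
    (h0 : (toPoly a).coeff N = 0) : a ∈ filt K lam N := by
  obtain ⟨a', ha', b, hb, rfl⟩ := Submodule.mem_sup.mp ha
  obtain ⟨c, rfl⟩ := (Submodule.mem_span_range_iff_exists_fun K).mp hb
  rw [map_add, coeff_add, coeff_toPoly_of_mem_filt le_rfl ha', zero_add, map_sum,
    finsetSum_coeff] at h0
  choose κ hκ hκ' using fun l : Fin (2 * N + 1) =>
    (coeff_toPoly_stdMonomial (lam := lam) (Nat.le_of_lt_succ l.2))
  have hc (l : Fin (2 * N + 1)) : c l = 0 := by
    have h := congrArg (fun p : K[X] => p.coeff l) h0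
    simp only [map_smul, coeff_smul, hκ', finsetSum_coeff, coeff_C_mul, coeff_X_pow] at h
    rw [Finset.sum_eq_single l] at h
    · simpa [hκ] using h
    · intro i _ hi
      simp [Fin.val_ne_of_ne hi.symm]
    · simp
  rw [Finset.sum_eq_zero fun l _ => by rw [hc, zero_smul], add_zero]
  exact ha'

/-- The degree of an element of `P_λ` in `e, h, f`. -/
def deg (a : PQ K lam) : ℕ := (toPoly a).natDegree

lemma mem_filt_of_coeff {N : ℕ} {a : PQ K lam} (h : ∀ n, N ≤ n → (toPoly a).coeff n = 0) :
    a ∈ filt K lam N := by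
  obtain ⟨M, hM⟩ := exists_mem_stdFiltration a
  induction M with
  | zero => exact stdFiltration_mono (Nat.zero_le N) hM
  | succ M ih =>
    rcases le_or_gt N M with hNM | hNM
    · exact ih (mem_filt_of_coeff_eq_zero hM (h M hNM))
    · exact stdFiltration_mono hNM hM

lemma mem_filt_succ_deg (a : PQ K lam) : a ∈ filt K lam (deg a + 1) :=
  mem_filt_of_coeff fun _ hn => coeff_eq_zero_of_natDegree_lt hn

lemma toPoly_injective : Function.Injective (toPoly (lam := lam)) := by
  rw [injective_iff_map_eq_zero]
  intro a ha
  have h : a ∈ filt K lam 0 := mem_filt_of_coeff fun n _ => by rw [ha, coeff_zero]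
  exact (Submodule.mem_bot K).mp h

instance : IsDomain (PQ K lam) := toPoly_injective.isDomain toPoly.toRingHom

lemma exists_eq_of_deg_le_one {a : PQ K lam} (ha : deg a ≤ 1) :
    ∃ x y z w : K, a = x • pe K lam + y • ph K lam + z • pf K lam + algebraMap K _ w := by
  let S : Submodule K (PQ K lam) :=
    Submodule.span K {pe K lam} ⊔ Submodule.span K {ph K lam} ⊔ Submodule.span K {pf K lam} ⊔
      Submodule.span K {1}
  have h1 : (1 : PQ K lam) ∈ S := Submodule.mem_sup_right (Submodule.mem_span_singleton_self _)
  have hf : pf K lam ∈ S :=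
    Submodule.mem_sup_left (Submodule.mem_sup_right (Submodule.mem_span_singleton_self _))
  have hh : ph K lam ∈ S := Submodule.mem_sup_left
    (Submodule.mem_sup_left (Submodule.mem_sup_right (Submodule.mem_span_singleton_self _)))
  have he : pe K lam ∈ S := Submodule.mem_sup_left
    (Submodule.mem_sup_left (Submodule.mem_sup_left (Submodule.mem_span_singleton_self _)))
  have key : a ∈ S := by
    refine stdFiltration_le (N := 2) (fun n i hN => ?_) (fun n i hN => ?_)
      (stdFiltration_mono (by omega) (mem_filt_succ_deg a))
    · obtain ⟨rfl, rfl⟩ | ⟨rfl, rfl⟩ | ⟨rfl, rfl⟩ :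
        (n = 0 ∧ i = 0) ∨ (n = 1 ∧ i = 0) ∨ (n = 0 ∧ i = 1) := by omega
      · simpa using h1
      · simpa using hh
      · simpa using hf
    · obtain ⟨rfl, rfl⟩ | ⟨rfl, rfl⟩ | ⟨rfl, rfl⟩ :
        (n = 0 ∧ i = 0) ∨ (n = 1 ∧ i = 0) ∨ (n = 0 ∧ i = 1) := by omega
      · simpa using h1
      · simpa using hh
      · simpa using he
  obtain ⟨u, hu, r, hr, rfl⟩ := Submodule.mem_sup.mp key
  obtain ⟨v, hv, q, hq, rfl⟩ := Submodule.mem_sup.mp hu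
  obtain ⟨w, hw, p, hp, rfl⟩ := Submodule.mem_sup.mp hv
  obtain ⟨w, rfl⟩ := Submodule.mem_span_singleton.mp hw
  obtain ⟨p, rfl⟩ := Submodule.mem_span_singleton.mp hp
  obtain ⟨q, rfl⟩ := Submodule.mem_span_singleton.mp hq
  obtain ⟨r, rfl⟩ := Submodule.mem_span_singleton.mp hr
  exact ⟨w, p, q, r, by rw [Algebra.algebraMap_eq_smul_one]⟩

lemma exists_eq_algebraMap_of_deg_eq_zero {a : PQ K lam} (ha : deg a = 0) :
    ∃ r, a = algebraMap K _ r := by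
  have h := stdFiltration_le (N := 1) (S := Submodule.span K {(1 : PQ K lam)})
    (fun n i hN => ?_) (fun n i hN => ?_) (stdFiltration_mono (by omega) (mem_filt_succ_deg a))
  · obtain ⟨r, rfl⟩ := Submodule.mem_span_singleton.mp h
    exact ⟨r, by rw [Algebra.algebraMap_eq_smul_one]⟩
  all_goals
    obtain ⟨rfl, rfl⟩ : n = 0 ∧ i = 0 := by omega
    rw [pow_zero, pow_zero, mul_one]
    exact Submodule.mem_span_singleton_self _

end Filtration

section NormalForm

open Polynomial

lemma exists_eq_aevalAeval_add (a : PQ K lam) : ∃ A B : K[X][X],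
    a = aevalAeval (ph K lam) (pf K lam) A + aevalAeval (ph K lam) (pe K lam) B := by
  have key : a ∈ LinearMap.range (aevalAeval (R := K) (ph K lam) (pf K lam)).toLinearMap ⊔
      LinearMap.range (aevalAeval (R := K) (ph K lam) (pe K lam)).toLinearMap := by
    refine stdFiltration_le (fun n i _ => Submodule.mem_sup_left ?_)
      (fun n i _ => Submodule.mem_sup_right ?_) (mem_filt_succ_deg a)
    · exact LinearMap.mem_range.mpr ⟨C (X ^ n) * X ^ i, by simp⟩
    · exact LinearMap.mem_range.mpr ⟨C (X ^ n) * X ^ i, by simp [mul_comm]⟩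
  obtain ⟨_, ⟨A, rfl⟩, _, ⟨B, rfl⟩, h⟩ := Submodule.mem_sup.mp key
  exact ⟨A, B, h.symm⟩

lemma aevalAeval_eq_sum {R : Type*} [CommRing R] [Algebra K R] (x y : R) (g : K[X][X]) {n : ℕ}
    (hn : g.natDegree < n) :
    aevalAeval x y g = ∑ i ∈ Finset.range n, aeval x (g.coeff i) * y ^ i := by
  conv_lhs => rw [g.as_sum_range_C_mul_X_pow' hn]
  simp [map_sum]

lemma exists_aevalAeval_eq_sum {R : Type*} [CommRing R] [Algebra K R] (x y : R) (g : K[X][X]) :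
    ∃ s : Finset (ℕ × ℕ), (∀ i, i ∈ s ↔ (g.coeff i.1).coeff i.2 ≠ 0) ∧
      aevalAeval x y g = ∑ i ∈ s, (g.coeff i.1).coeff i.2 • (y ^ i.1 * x ^ i.2) := by
  classical
  set M := g.support.sup (fun i => (g.coeff i).natDegree) with hM
  have hM' (i : ℕ) : (g.coeff i).natDegree < M + 1 := by
    by_cases hi : i ∈ g.support
    · exact Nat.lt_succ_of_le (Finset.le_sup (f := fun i => (g.coeff i).natDegree) hi)
    · simp [notMem_support_iff.mp hi]
  refine ⟨(Finset.range (g.natDegree + 1) ×ˢ Finset.range (M + 1)).filter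
    (fun i => (g.coeff i.1).coeff i.2 ≠ 0), fun i => ?_, ?_⟩
  · simp only [Finset.mem_filter, Finset.mem_product, Finset.mem_range, and_iff_right_iff_imp]
    intro hi
    refine ⟨Nat.lt_succ_of_le (le_natDegree_of_ne_zero fun h => hi (by rw [h, coeff_zero])), ?_⟩
    exact (le_natDegree_of_ne_zero hi).trans_lt (hM' _)
  · rw [Finset.sum_filter_of_ne, Finset.sum_product, aevalAeval_eq_sum x y g (Nat.lt_succ_self _)]
    · refine Finset.sum_congr rfl fun i _ => ?_
      rw [aeval_eq_sum_range' (hM' i), Finset.sum_mul]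
      refine Finset.sum_congr rfl fun j _ => ?_
      rw [smul_mul_assoc, mul_comm]
    · intro i _ hi h
      exact hi (by rw [h, zero_smul])

lemma exists_pf_pow_mul_eq_sum (a : PQ K lam) :
    ∃ (k : ℕ) (s : Finset (ℕ × ℕ)) (c : ℕ × ℕ → K), (∀ i ∈ s, c i ≠ 0) ∧
      pf K lam ^ k * a = ∑ i ∈ s, c i • (pf K lam ^ i.1 * ph K lam ^ i.2) ∧
      (k = 0 ∨ ∃ i ∈ s, 2 * k ≤ i.2) := by
  obtain ⟨A, B, ha⟩ := exists_eq_aevalAeval_add a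
  set k := B.natDegree with hk
  set p : K[X] := C (1 / 4) * (C lam - X ^ 2) with hp
  have hp2 : p.natDegree = 2 := by
    rw [hp, natDegree_C_mul (by norm_num)]
    compute_degree!
  have hpe : pf K lam * pe K lam = aeval (ph K lam) p := by
    have h := rel_eq (lam := lam)
    have h4 : (4 : PQ K lam) * algebraMap K _ (1 / 4) = 1 := by
      rw [← map_ofNat (algebraMap K (PQ K lam)) 4, ← map_mul]; simp
    simp only [hp, map_mul, map_sub, aeval_C, map_pow, aeval_X]
    linear_combination (algebraMap K (PQ K lam) (1 / 4)) * h - pf K lam * pe K lam * h4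
  set g : K[X][X] := X ^ k * A + ∑ j ∈ Finset.range (k + 1), C (p ^ j * B.coeff j) * X ^ (k - j)
    with hg
  have hga : pf K lam ^ k * a = aevalAeval (ph K lam) (pf K lam) g := by
    rw [ha, mul_add, hg, map_add, map_mul, map_pow, aevalAeval_Y,
      aevalAeval_eq_sum _ _ B (Nat.lt_succ_self _), map_sum, Finset.mul_sum]
    congr 1
    refine Finset.sum_congr rfl fun j hj => ?_
    rw [map_mul, aevalAeval_C, map_mul, map_pow, map_pow, aevalAeval_Y, ← hpe,
      ← pow_mul_pow_sub (pf K lam) (Nat.le_of_lt_succ (Finset.mem_range.mp hj))]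
    ring
  obtain ⟨s, hs, hsum⟩ := exists_aevalAeval_eq_sum (ph K lam) (pf K lam) g
  refine ⟨k, s, fun i => (g.coeff i.1).coeff i.2, fun i hi => (hs i).mp hi, hga.trans hsum, ?_⟩
  rcases Nat.eq_zero_or_pos k with h0 | h0
  · exact Or.inl h0
  have hB : B.coeff k ≠ 0 := by
    rw [hk, coeff_natDegree]
    rintro h
    rw [leadingCoeff_eq_zero.mp h, natDegree_zero] at hk
    omega
  have hp0 : p ≠ 0 := by rintro h; rw [h, natDegree_zero] at hp2; omega
  have hg0 : g.coeff 0 = p ^ k * B.coeff k := by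
    rw [hg, coeff_add, finsetSum_coeff, Finset.sum_eq_single k, mul_coeff_zero, coeff_X_pow,
      if_neg h0.ne, zero_mul, zero_add, Nat.sub_self, pow_zero, mul_one, coeff_C_zero]
    · intro j hj hjk
      have := Finset.mem_range.mp hj
      rw [coeff_C_mul, coeff_X_pow, if_neg (by omega), mul_zero]
    · simp
  refine Or.inr ⟨(0, (g.coeff 0).natDegree), (hs _).mpr ?_, ?_⟩
  · dsimp only
    rw [coeff_natDegree, leadingCoeff_ne_zero, hg0]
    exact mul_ne_zero (pow_ne_zero _ hp0) hB
  · dsimp only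
    rw [hg0, natDegree_mul (pow_ne_zero _ hp0) hB, natDegree_pow, hp2]
    omega

end NormalForm

section Automorphisms

open Polynomial

lemma PQ.smul_eq (r : K) (a : PQ K lam) : r • a = algebraMap K (PQ K lam) r * a :=
  Algebra.smul_def r a

variable {B : PoissonBr K lam}

lemma PAut.map_algebraMap (φ : PAut B) (r : K) :
    φ.val (algebraMap K (PQ K lam) r) = algebraMap K (PQ K lam) r := φ.val.commutes r

lemma PAut.map_smul (φ : PAut B) (r : K) (a : PQ K lam) : φ.val (r • a) = r • φ.val a := by
  rw [PQ.smul_eq, PQ.smul_eq, map_mul, PAut.map_algebraMap φ]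

lemma PAut.mul_apply (φ ψ : PAut B) (a : PQ K lam) : (φ * ψ).val a = φ.val (ψ.val a) := rfl

lemma PAut.inv_apply_eq (φ : PAut B) {a b : PQ K lam} (h : φ.val a = b) : (φ⁻¹).val b = a := by
  rw [← h, ← PAut.mul_apply, inv_mul_cancel]; rfl

lemma PAut.apply_inv_apply (φ : PAut B) (a : PQ K lam) : φ.val ((φ⁻¹).val a) = a := by
  rw [← PAut.mul_apply, mul_inv_cancel]; rfl

lemma pf_ne_zero : pf K lam ≠ 0 := fun h => by
  have := toPoly_pf (lam := lam)
  rw [h, map_zero] at this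
  exact X_ne_zero this.symm

lemma PAut.map_ne_zero (φ : PAut B) {a : PQ K lam} (ha : a ≠ 0) : φ.val a ≠ 0 := fun h =>
  ha (φ.val.injective (h.trans (map_zero φ.val).symm))

lemma PAut.rel (φ : PAut B) : 4 * φ.val (pe K lam) * φ.val (pf K lam) + φ.val (ph K lam) ^ 2 =
    algebraMap K (PQ K lam) lam := by
  have h := congrArg φ.val (rel_eq (lam := lam))
  rwa [PAut.map_algebraMap φ, map_add, map_mul, map_mul, map_pow, map_ofNat] at h

lemma PQ.four_ne_zero : (4 : PQ K lam) ≠ 0 := by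
  rw [← map_ofNat (algebraMap K (PQ K lam)) 4]
  exact (_root_.map_ne_zero _).mpr (by norm_num)

lemma PAut.ext_of_hf {φ ψ : PAut B} (hh : φ.val (ph K lam) = ψ.val (ph K lam))
    (hf : φ.val (pf K lam) = ψ.val (pf K lam)) : φ = ψ := by
  have he : φ.val (pe K lam) = ψ.val (pe K lam) := by
    refine mul_left_cancel₀ (mul_ne_zero PQ.four_ne_zero (PAut.map_ne_zero ψ pf_ne_zero)) ?_
    have h1 := PAut.rel φ
    have h2 := PAut.rel ψ
    rw [hh, hf] at h1
    linear_combination h1 - h2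
  refine Subtype.ext (AlgEquiv.ext fun a => ?_)
  induction a using PQ.induction with
  | hC r => exact (PAut.map_algebraMap φ r).trans (PAut.map_algebraMap ψ r).symm
  | hadd a b ha hb => rw [map_add, map_add, ha, hb]
  | he a ha => rw [map_mul, map_mul, ha, he]
  | hh a ha => rw [map_mul, map_mul, ha, hh]
  | hf a ha => rw [map_mul, map_mul, ha, hf]

lemma mem_CsetLT_of_hf {φ : PAut B} {γ δ : K} (hγ : γ ≠ 0)
    (hh : φ.val (ph K lam) = ph K lam + δ • pf K lam) (hf : φ.val (pf K lam) = γ • pf K lam) :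
    φ ∈ CsetLT B := by
  refine ⟨-(δ * γ⁻¹ / 2), (Units.mk0 γ hγ)⁻¹, ?_, ?_, ?_⟩
  · have h1 := PAut.rel φ
    have h2 := rel_eq (lam := lam)
    refine mul_left_cancel₀ (mul_ne_zero PQ.four_ne_zero (PAut.map_ne_zero φ pf_ne_zero)) ?_
    rw [hh, hf] at h1
    rw [hf]
    simp only [PQ.smul_eq, Units.val_inv_eq_inv_val, Units.val_mk0] at h1 ⊢
    have h3 : algebraMap K (PQ K lam) γ * algebraMap K (PQ K lam) γ⁻¹ = 1 := by
      rw [← map_mul, mul_inv_cancel₀ hγ, map_one]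
    have h4 : algebraMap K (PQ K lam) (-(δ * γ⁻¹ / 2)) * 2 =
        - (algebraMap K (PQ K lam) δ * algebraMap K (PQ K lam) γ⁻¹) := by
      rw [← map_ofNat (algebraMap K (PQ K lam)) 2, ← map_mul, ← map_mul, ← map_neg]
      congr 1; ring
    have h5 : algebraMap K (PQ K lam) ((-(δ * γ⁻¹ / 2)) ^ 2 / γ⁻¹) * 4 =
        algebraMap K (PQ K lam) δ ^ 2 * algebraMap K (PQ K lam) γ⁻¹ := by
      rw [← map_ofNat (algebraMap K (PQ K lam)) 4, ← map_mul, ← map_pow, ← map_mul]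
      congr 1; field_simp; norm_num
    set γ₁ := algebraMap K (PQ K lam) γ
    set δ₁ := algebraMap K (PQ K lam) δ
    linear_combination h1 - h2 - (4 * pe K lam * pf K lam) * h3
      - 2 * γ₁ * pf K lam * ph K lam * h4 + 2 * pf K lam * ph K lam * δ₁ * h3
      + γ₁ * pf K lam ^ 2 * h5 + pf K lam ^ 2 * δ₁ ^ 2 * h3
  · rw [hh, Units.val_inv_eq_inv_val, Units.val_mk0, PQ.smul_eq, PQ.smul_eq,
      show 2 * -(δ * γ⁻¹ / 2) / γ⁻¹ = -δ by field_simp, map_neg]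
    ring
  · rw [hf, Units.val_inv_eq_inv_val, Units.val_mk0, inv_inv]

lemma PAut.map_aeval (φ : PAut B) (a : PQ K lam) (g : K[X]) :
    φ.val (aeval a g) = aeval (φ.val a) g :=
  (Polynomial.aeval_algHom_apply φ.val a g).symm

lemma delta_mul {Δ : K[X] → PAut B} (hΔ : ∀ g, IsDelta B g (Δ g)) (r q : K[X]) :
    Δ r * Δ q = Δ (r + q) := by
  refine PAut.ext_of_hf ?_ ?_
  · rw [PAut.mul_apply, (hΔ q).2.1, map_add, map_mul, map_mul, map_ofNat, PAut.map_aeval,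
      (hΔ r).2.1, (hΔ r).2.2, (hΔ (r + q)).2.1, map_add]
    ring
  · rw [PAut.mul_apply, (hΔ q).2.2, (hΔ r).2.2, (hΔ (r + q)).2.2]

lemma delta_zero {Δ : K[X] → PAut B} (hΔ : ∀ g, IsDelta B g (Δ g)) : Δ 0 = 1 := by
  have h := delta_mul hΔ 0 0
  rwa [add_zero, mul_eq_left] at h

lemma delta_neg {Δ : K[X] → PAut B} (hΔ : ∀ g, IsDelta B g (Δ g)) (g : K[X]) :
    Δ g * Δ (-g) = 1 := by
  rw [delta_mul hΔ, add_neg_cancel, delta_zero hΔ]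

lemma exists_mul_delta_eq {Δ : K[X] → PAut B} (hΔ : ∀ g, IsDelta B g (Δ g)) {c : PAut B}
    (hc : c ∈ CsetLT B) (g : K[X]) :
    ∃ q : K[X], q.eval 0 = 0 ∧ ∃ c' ∈ CsetLT B, c * Δ g = Δ q * c' := by
  obtain ⟨α, β, -, hh, hf⟩ := hc
  set q : K[X] := C (β : K)⁻¹ * (g.comp (C (β : K)⁻¹ * X) - C (g.eval 0)) with hq
  refine ⟨q, ?_, Δ (-q) * (c * Δ g), ?_, ?_⟩
  · simp [hq]
  · refine mem_CsetLT_of_hf (γ := (β : K)⁻¹) (δ := 2 * (β : K)⁻¹ * g.eval 0 - 2 * α / β)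
      (inv_ne_zero β.ne_zero) ?_ ?_
    · rw [PAut.mul_apply, PAut.mul_apply, (hΔ g).2.1, map_add, map_mul, map_mul, map_ofNat,
        PAut.map_aeval, hh, hf, map_add, map_mul, map_mul, map_ofNat, PAut.map_aeval, map_sub,
        PAut.map_smul, PAut.map_smul, (hΔ (-q)).2.1, (hΔ (-q)).2.2]
      have hcomp : aeval (pf K lam) (g.comp (C (β : K)⁻¹ * X)) =
          aeval ((β : K)⁻¹ • pf K lam) g := by
        rw [aeval_comp, map_mul, aeval_C, aeval_X, PQ.smul_eq]
      have hqf : aeval (pf K lam) q = algebraMap K _ (β : K)⁻¹ *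
          (aeval ((β : K)⁻¹ • pf K lam) g - algebraMap K _ (g.eval 0)) := by
        rw [hq, map_mul, map_sub, aeval_C, aeval_C, hcomp]
      rw [map_neg, hqf, PQ.smul_eq (2 * α / β : K), PQ.smul_eq (_ - _ : K), map_sub,
        map_mul, map_mul, map_ofNat, PQ.smul_eq (β : K)⁻¹]
      ring
    · rw [PAut.mul_apply, PAut.mul_apply, (hΔ g).2.2, hf, PAut.map_smul, (hΔ (-q)).2.2]
  · rw [← mul_assoc, delta_neg hΔ, one_mul]

/-- `φ` maps the elements of degree at most one in `e, h, f` to elements of degree at most one. -/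
def IsLin (φ : PAut B) : Prop := ∀ a, deg a ≤ 1 → deg (φ.val a) ≤ 1

lemma IsLin.mul {φ ψ : PAut B} (hφ : IsLin φ) (hψ : IsLin ψ) : IsLin (φ * ψ) :=
  fun a ha => hφ _ (hψ a ha)

lemma deg_add_le {a b : PQ K lam} {n : ℕ} (ha : deg a ≤ n) (hb : deg b ≤ n) : deg (a + b) ≤ n := by
  rw [deg, map_add]; exact natDegree_add_le_of_degree_le ha hb

lemma deg_neg (a : PQ K lam) : deg (-a) = deg a := by
  rw [deg, map_neg, natDegree_neg]; rfl

lemma deg_sub_le {a b : PQ K lam} {n : ℕ} (ha : deg a ≤ n) (hb : deg b ≤ n) : deg (a - b) ≤ n := by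
  rw [sub_eq_add_neg]; exact deg_add_le ha ((deg_neg b).trans_le hb)

lemma deg_algebraMap (r : K) : deg (algebraMap K (PQ K lam) r) = 0 := by
  rw [deg, AlgHom.commutes]; exact natDegree_C _

lemma deg_smul_le (r : K) {a : PQ K lam} {n : ℕ} (ha : deg a ≤ n) : deg (r • a) ≤ n := by
  rw [PQ.smul_eq, deg, map_mul, AlgHom.commutes]
  exact (natDegree_C_mul_le _ _).trans ha

lemma deg_pf : deg (pf K lam) = 1 := by rw [deg, toPoly_pf, natDegree_X]

lemma deg_ph : deg (ph K lam) = 1 := by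
  refine natDegree_eq_of_le_of_coeff_ne_zero natDegree_toPoly_ph_le ?_
  rw [coeff_toPoly_ph]
  exact mul_ne_zero (by simp) X_ne_zero

lemma deg_pe : deg (pe K lam) = 1 := by
  refine natDegree_eq_of_le_of_coeff_ne_zero natDegree_toPoly_pe_le ?_
  rw [coeff_toPoly_pe]
  exact mul_ne_zero (C_ne_zero.mpr (by norm_num)) (pow_ne_zero _ X_ne_zero)

lemma isLin_of_gens {φ : PAut B} (he : deg (φ.val (pe K lam)) ≤ 1)
    (hh : deg (φ.val (ph K lam)) ≤ 1) (hf : deg (φ.val (pf K lam)) ≤ 1) : IsLin φ := by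
  intro a ha
  obtain ⟨x, y, z, w, rfl⟩ := exists_eq_of_deg_le_one ha
  rw [map_add, map_add, map_add, PAut.map_smul, PAut.map_smul, PAut.map_smul, PAut.map_algebraMap]
  exact deg_add_le (deg_add_le (deg_add_le (deg_smul_le x he) (deg_smul_le y hh))
    (deg_smul_le z hf)) ((deg_algebraMap w).trans_le zero_le_one)

lemma isLin_one : IsLin (1 : PAut B) := fun _ ha => ha

lemma IsTauA.isLin {α : K} {φ : PAut B} (h : IsTauA B α φ) : IsLin φ := by
  refine isLin_of_gens ?_ ?_ ?_
  · rw [h.1]; exact deg_pf.le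
  · rw [h.2.1]; exact deg_add_le ((deg_neg _).trans_le deg_ph.le) (deg_smul_le _ deg_pf.le)
  · rw [h.2.2]
    exact deg_sub_le (deg_add_le deg_pe.le (deg_smul_le _ deg_ph.le)) (deg_smul_le _ deg_pf.le)

lemma isLin_of_mem_CsetLT {φ : PAut B} (h : φ ∈ CsetLT B) : IsLin φ := by
  obtain ⟨α, β, he, hh, hf⟩ := h
  refine isLin_of_gens ?_ ?_ ?_
  · rw [he]
    exact deg_sub_le (deg_add_le (deg_smul_le _ deg_pe.le) (deg_smul_le _ deg_ph.le))
      (deg_smul_le _ deg_pf.le)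
  · rw [hh]; exact deg_sub_le deg_ph.le (deg_smul_le _ deg_pf.le)
  · rw [hf]; exact deg_smul_le _ deg_pf.le

variable (lam) in
/-- The element `x e + y h + z f + w` of `P_λ`. -/
def linComb (x y z w : K) : PQ K lam :=
  x • pe K lam + y • ph K lam + z • pf K lam + algebraMap K _ w

lemma linComb_inj {x y z w x' y' z' w' : K} (h : linComb lam x y z w = linComb lam x' y' z' w') :
    x = x' ∧ y = y' ∧ z = z' ∧ w = w' := by
  have h1 := congrArg (fun a => (toPoly a).coeff 1) h
  simp only [linComb, PQ.smul_eq, map_add, map_mul, AlgHom.commutes, Polynomial.coeff_add,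
    show ∀ r, algebraMap K K[X][X] r = C (C r) from fun _ => rfl, coeff_C_mul, toPoly_pf,
    coeff_toPoly_ph, coeff_toPoly_pe, coeff_X_one, coeff_C_succ] at h1
  have hx := congrArg (fun p : K[X] => p.coeff 2) h1
  have hy := congrArg (fun p : K[X] => p.coeff 1) h1
  have hz := congrArg (fun p : K[X] => p.coeff 0) h1
  simp [coeff_X, coeff_C, coeff_X_pow] at hx hy hz
  subst hx hy hz
  rw [linComb, linComb, add_right_inj] at h
  exact ⟨rfl, rfl, rfl, (algebraMap K (PQ K lam)).injective h⟩

lemma br_linComb (x y z w x' y' z' w' : K) :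
    B.br (linComb lam x y z w) (linComb lam x' y' z' w') =
      linComb lam (2 * (y * x' - x * y')) (x * z' - z * x') (2 * (z * y' - y * z')) 0 := by
  have br_const (r : K) (a : PQ K lam) : B.br (algebraMap K _ r) a = 0 := by
    rw [B.br_swap, B.br_algebraMap, neg_zero]
  have hfe : B.br (pf K lam) (pe K lam) = -ph K lam := by rw [B.br_swap, B.br_ef]
  have heh : B.br (pe K lam) (ph K lam) = -(2 * pe K lam) := by rw [B.br_swap, B.br_he]
  have hfh : B.br (pf K lam) (ph K lam) = 2 * pf K lam := by rw [B.br_swap, B.br_hf]; ring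
  simp only [linComb, B.add_left, B.add_right, B.smul_left, B.smul_right, B.alternate,
    B.br_algebraMap, br_const, B.br_ef, B.br_he, B.br_hf, hfe, heh, hfh]
  simp only [PQ.smul_eq, map_mul, map_sub, map_ofNat, map_zero]
  ring

lemma smul_linComb (r x y z w : K) :
    r • linComb lam x y z w = linComb lam (r * x) (r * y) (r * z) (r * w) := by
  simp only [linComb, PQ.smul_eq, map_mul]
  ring

lemma IsLin.exists_eq_mul {τf : K → PAut B} (hτf : ∀ α, IsTauA B α (τf α)) {φ : PAut B}
    (hφ : IsLin φ) : ∃ α ∈ ({1} ∪ Set.range τf : Set (PAut B)), ∃ c ∈ CsetLT B, φ = α * c := by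
  obtain ⟨p, q, r, s, hE⟩ := exists_eq_of_deg_le_one (hφ _ deg_pe.le)
  obtain ⟨a', b', c', w', hH⟩ := exists_eq_of_deg_le_one (hφ _ deg_ph.le)
  obtain ⟨a, b, c, w, hF⟩ := exists_eq_of_deg_le_one (hφ _ deg_pf.le)
  change _ = linComb lam p q r s at hE
  change _ = linComb lam a' b' c' w' at hH
  change _ = linComb lam a b c w at hF
  have hEF := φ.2 (pe K lam) (pf K lam)
  have hHF := φ.2 (ph K lam) (pf K lam)
  rw [B.br_ef, hE, hF, br_linComb, hH] at hEF
  rw [B.br_hf, hH, hF, br_linComb, show -2 * pf K lam = (-2 : K) • pf K lam by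
    rw [PQ.smul_eq, map_neg, map_ofNat], PAut.map_smul, hF, smul_linComb] at hHF
  obtain ⟨-, -, -, hw'⟩ := linComb_inj hEF
  obtain ⟨h1, h2, h3, h4⟩ := linComb_inj hHF
  have hw : w = 0 := by simpa using h4
  subst hw hw'
  have hbac : b ^ 2 = -(a * c) := by linear_combination (-b / 2) * h2 - (a / 4) * h3 - (c / 4) * h1
  have hF0 := PAut.map_ne_zero φ pf_ne_zero
  rcases eq_or_ne a 0 with rfl | ha
  · have hb : b = 0 := by simpa using hbac
    subst hb
    have hc : c ≠ 0 := by
      rintro rfl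
      exact hF0 (hF.trans (by simp [linComb]))
    have ha' : a' = 0 := by simpa [hc] using h2
    have hb' : b' = 1 := mul_right_cancel₀ hc (by linear_combination (1 / 2) * h3)
    subst ha' hb'
    refine ⟨1, Or.inl rfl, φ, mem_CsetLT_of_hf (γ := c) (δ := c') hc ?_ ?_, (one_mul _).symm⟩
    · rw [hH, linComb, map_zero, zero_smul, one_smul, zero_add, add_zero]
    · rw [hF, linComb, map_zero, zero_smul, zero_smul, zero_add, zero_add, add_zero]
  · refine ⟨τf (b / a), Or.inr ⟨_, rfl⟩, (τf (b / a))⁻¹ * φ,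
      mem_CsetLT_of_hf (γ := a) (δ := a') ha ?_ ?_, (mul_inv_cancel_left _ _).symm⟩
    · rw [PAut.mul_apply, hH]
      refine PAut.inv_apply_eq _ ?_
      rw [map_add, PAut.map_smul, (hτf _).2.1, (hτf _).2.2]
      have e2 : b' = -1 + a' * (b / a) := by field_simp; linear_combination (-1 / 2) * h1
      have e3 : c' = 2 * (b / a) - a' * (b / a) ^ 2 := by
        field_simp; linear_combination a * h2 + a' * hbac
      rw [e2, e3, linComb]
      simp only [PQ.smul_eq, map_add, map_neg, map_mul, map_sub, map_pow, map_one, map_ofNat,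
        map_zero]
      ring
    · rw [PAut.mul_apply, hF]
      refine PAut.inv_apply_eq _ ?_
      rw [PAut.map_smul, (hτf _).2.2, linComb]
      have e2 : a * (b / a) = b := by field_simp
      have e3 : -(a * (b / a) ^ 2) = c := by field_simp; linear_combination -hbac
      rw [map_zero, ← e3, neg_smul, smul_sub, smul_add, smul_smul, smul_smul, e2]
      ring

lemma deg_map_ne_zero (φ : PAut B) {a : PQ K lam} (ha : deg a ≠ 0) : deg (φ.val a) ≠ 0 := by
  intro h
  obtain ⟨r, hr⟩ := exists_eq_algebraMap_of_deg_eq_zero h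
  rw [← PAut.map_algebraMap φ] at hr
  exact ha (by rw [φ.val.injective hr, deg_algebraMap])

lemma toPoly_eq_zero {a : PQ K lam} : toPoly a = 0 ↔ a = 0 :=
  map_eq_zero_iff _ toPoly_injective

lemma deg_pe_add_deg_pf (φ : PAut B) :
    deg (φ.val (pe K lam)) + deg (φ.val (pf K lam)) = 2 * deg (φ.val (ph K lam)) := by
  have h := congrArg toPoly (PAut.rel φ)
  rw [AlgHom.commutes, map_add, map_pow, map_mul, map_mul, map_ofNat] at h
  have hpe : pe K lam ≠ 0 := fun h => by simpa [h, deg] using deg_pe (lam := lam)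
  have hF : toPoly (φ.val (pf K lam)) ≠ 0 := toPoly_eq_zero.not.mpr (PAut.map_ne_zero φ pf_ne_zero)
  have hE : toPoly (φ.val (pe K lam)) ≠ 0 := toPoly_eq_zero.not.mpr (PAut.map_ne_zero φ hpe)
  have hH : (toPoly (φ.val (ph K lam))).natDegree ≠ 0 :=
    deg_map_ne_zero φ (by rw [deg_ph]; exact one_ne_zero)
  have h5 : (4 : K[X]) ≠ 0 := by norm_num
  have h6 : C 4 * (toPoly (φ.val (pe K lam)) * toPoly (φ.val (pf K lam))) =
      C (C lam) - toPoly (φ.val (ph K lam)) ^ 2 := by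
    rw [show algebraMap K K[X][X] lam = C (C lam) from rfl] at h
    rw [show (C 4 : K[X][X]) = 4 from rfl]
    linear_combination h
  have h7 := congrArg natDegree h6
  rwa [natDegree_C_mul h5, natDegree_mul hE hF, natDegree_sub_eq_right_of_natDegree_lt,
      natDegree_pow]
    at h7
  rw [natDegree_C, natDegree_pow]
  omega

lemma polyBr_map_pf_ph (φ : PAut B) :
    polyBr (toPoly (φ.val (pf K lam))) (toPoly (φ.val (ph K lam))) =
      2 * toPoly (φ.val (pf K lam)) := by
  have h : B.br (pf K lam) (ph K lam) = 2 * pf K lam := by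
    rw [B.br_swap, B.br_hf]
    ring
  rw [← toPoly_br B, ← φ.2, h, map_mul, map_mul, map_ofNat, map_ofNat]

lemma natDegree_dvd_natDegree_sum_smul_pow {F : K[X][X]} (s : Finset (ℕ × ℕ)) (c : ℕ × ℕ → K) :
    F.natDegree ∣ (∑ i ∈ s, c i • F ^ i.1).natDegree := by
  have h : ∑ i ∈ s, c i • F ^ i.1 = (∑ i ∈ s, C (C (c i)) * X ^ i.1 : K[X][X]).comp F := by
    rw [Polynomial.sum_comp]
    refine Finset.sum_congr rfl fun i _ => ?_
    rw [C_mul_comp, X_pow_comp, Algebra.smul_def]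
    rfl
  rw [h, natDegree_comp]
  exact dvd_mul_left _ _

lemma deg_pf_dvd_deg_ph (φ : PAut B) (h2 : 2 ≤ deg (φ.val (ph K lam)))
    (hle : deg (φ.val (pf K lam)) ≤ deg (φ.val (ph K lam))) :
    deg (φ.val (pf K lam)) ∣ deg (φ.val (ph K lam)) := by
  by_contra hdvd
  obtain ⟨k, s, c, hc, hsum, hk⟩ := exists_pf_pow_mul_eq_sum ((φ⁻¹).val (pe K lam))
  set m := deg (φ.val (pf K lam)) with hm
  set q := deg (φ.val (ph K lam)) with hq
  have hm0 : m ≠ 0 := deg_map_ne_zero φ (by rw [deg_pf]; exact one_ne_zero)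
  have hm1 : m ≠ 1 := fun h => hdvd (h ▸ one_dvd _)
  have hmq : m < q := lt_of_le_of_ne hle fun h => hdvd (h ▸ dvd_rfl)
  have hpe : toPoly (pe K lam) ≠ 0 := fun h => by simpa [h, deg] using deg_pe (lam := lam)
  have hF : toPoly (φ.val (pf K lam)) ≠ 0 := toPoly_eq_zero.not.mpr (PAut.map_ne_zero φ pf_ne_zero)
  replace hsum : toPoly (φ.val (pf K lam)) ^ k * toPoly (pe K lam) =
      ∑ i ∈ s, c i • (toPoly (φ.val (pf K lam)) ^ i.1 * toPoly (φ.val (ph K lam)) ^ i.2) := by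
    have h := congrArg (fun a => toPoly (φ.val a)) hsum
    simp only [map_mul, map_pow, PAut.apply_inv_apply, map_sum] at h
    rw [h]
    refine Finset.sum_congr rfl fun i _ => ?_
    rw [PAut.map_smul, map_smul, map_mul, map_mul, map_pow, map_pow, map_pow, map_pow]
  have hdeg := congrArg natDegree hsum
  rw [natDegree_mul (pow_ne_zero _ hF) hpe, natDegree_pow] at hdeg
  change k * m + deg (pe K lam) = _ at hdeg
  rw [deg_pe] at hdeg
  have hs : s.Nonempty := by
    by_contra hs
    rw [Finset.not_nonempty_iff_eq_empty.mp hs, Finset.sum_empty, natDegree_zero] at hdeg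
    omega
  obtain ⟨x, hx, hmax⟩ := Finset.exists_max_image s Prod.snd hs
  obtain ⟨t, ht, hd⟩ := exists_natDegree_sum_ge (F := toPoly (φ.val (pf K lam))) hm.symm hq.symm
    hm0 hdvd (polyBr_map_pf_ph φ) hc ⟨x, hx, rfl⟩ hmax
  rw [← hdeg] at hd
  have hkd : 2 * k ≤ x.2 := by
    rcases hk with rfl | ⟨y, hy, hky⟩
    · simp
    · exact hky.trans (hmax y hy)
  have hx1 : x.2 ≤ 1 := by nlinarith
  obtain rfl : k = 0 := by omega
  obtain rfl : t = 0 := by omega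
  rcases Nat.le_one_iff_eq_zero_or_eq_one.mp hx1 with hx0 | hx1
  · have hsnd : ∀ i ∈ s, i.2 = 0 := fun i hi => Nat.le_zero.mp (hx0 ▸ hmax i hi)
    rw [Finset.sum_congr rfl fun i hi => by rw [hsnd i hi, pow_zero, mul_one]] at hdeg
    have h := natDegree_dvd_natDegree_sum_smul_pow (F := toPoly (φ.val (pf K lam))) s c
    rw [← hdeg, zero_mul, zero_add] at h
    exact hm1 (Nat.dvd_one.mp h)
  · rw [hx1] at hd
    omega

lemma exists_deg_delta_lt {Δ : K[X] → PAut B} (hΔ : ∀ g, IsDelta B g (Δ g)) (φ : PAut B)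
    (h2 : 2 ≤ deg (φ.val (ph K lam)))
    (hle : deg (φ.val (pf K lam)) ≤ deg (φ.val (ph K lam))) :
    ∃ g, deg ((φ * Δ g).val (ph K lam)) < deg (φ.val (ph K lam)) := by
  obtain ⟨s, hs⟩ := deg_pf_dvd_deg_ph φ h2 hle
  set F := toPoly (φ.val (pf K lam)) with hF
  set H := toPoly (φ.val (ph K lam)) with hH
  set m := deg (φ.val (pf K lam)) with hm
  set q := deg (φ.val (ph K lam)) with hq
  obtain ⟨s, rfl⟩ : ∃ r, s = r + 1 := Nat.exists_eq_succ_of_ne_zero (by rintro rfl; omega)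
  have hFm : F.natDegree = m := rfl
  have hHq : H.natDegree = q := rfl
  have hm0 : m ≠ 0 := deg_map_ne_zero φ (by rw [deg_pf]; exact one_ne_zero)
  have hα : F.coeff m ≠ 0 := by
    rw [← hFm, coeff_natDegree, leadingCoeff_ne_zero, hF, Ne, toPoly_eq_zero]
    exact PAut.map_ne_zero φ pf_ne_zero
  obtain ⟨b, hb⟩ : ∃ b, H.coeff q = C b * F.coeff m ^ (s + 1) := by
    refine exists_eq_C_mul_of_derivative_mul_eq (pow_ne_zero _ hα) ?_
    have h := coeff_X_mul_polyBr hFm.le hHq.le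
    have h0 : (X * (2 * F)).coeff (m + q) = 0 := by
      refine coeff_eq_zero_of_natDegree_lt ?_
      have h1 := natDegree_mul_le (p := (X : K[X][X])) (q := C 2 * F)
      have h3 := natDegree_C_mul_le (2 : K[X]) F
      rw [natDegree_X] at h1
      change (X * (C 2 * F)).natDegree < _
      omega
    rw [polyBr_map_pf_ph φ, h0] at h
    have hqs : (q : K[X]) = m * (s + 1) := by rw [hs]; push_cast; ring
    rw [hqs] at h
    have h3 : (2 : K[X]) * m ≠ 0 := mul_ne_zero two_ne_zero (Nat.cast_ne_zero.mpr hm0)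
    have h4 : (s + 1) * derivative (F.coeff m) * H.coeff q =
        F.coeff m * derivative (H.coeff q) := by
      refine mul_left_cancel₀ h3 ?_
      linear_combination -h
    rw [derivative_pow_succ]
    simp only [map_add, map_natCast, map_one]
    linear_combination -(F.coeff m ^ s) * h4
  refine ⟨C (-b / 2) * X ^ s, ?_⟩
  have h : (φ * Δ (C (-b / 2) * X ^ s)).val (ph K lam) =
      φ.val (ph K lam) - b • φ.val (pf K lam) ^ (s + 1) := by
    rw [PAut.mul_apply, (hΔ _).2.1, map_add, map_mul, map_mul, PAut.map_aeval, map_mul, aeval_C,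
      map_pow, aeval_X, map_ofNat, PQ.smul_eq]
    have h2 : algebraMap K (PQ K lam) (-b / 2) * 2 = -algebraMap K (PQ K lam) b := by
      rw [← map_ofNat (algebraMap K (PQ K lam)) 2, ← map_mul, ← map_neg]
      congr 1; ring
    linear_combination (φ.val (pf K lam) ^ (s + 1)) * h2
  rw [h, deg, map_sub, map_smul, map_pow]
  change (H - b • F ^ (s + 1)).natDegree < q
  have hpow : (F ^ (s + 1)).natDegree ≤ q := by
    rw [natDegree_pow, hFm, hs, Nat.mul_comm]
  have hle' : (H - b • F ^ (s + 1)).natDegree ≤ q :=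
    (natDegree_sub_le _ _).trans (max_le hHq.le ((natDegree_smul_le _ _).trans hpow))
  have hcoeff : (H - b • F ^ (s + 1)).coeff q = 0 := by
    have h1 : (F ^ (s + 1)).coeff q = F.coeff m ^ (s + 1) := by
      rw [hs, Nat.mul_comm]
      exact coeff_pow_of_natDegree_le hFm.le
    rw [coeff_sub, coeff_smul, h1, hb, smul_eq_C_mul, sub_self]
  refine lt_of_le_of_ne hle' fun h => ?_
  rw [← h, coeff_natDegree, leadingCoeff_eq_zero] at hcoeff
  rw [hcoeff, natDegree_zero] at h
  omega

lemma tau_zero_mul_self {τf : K → PAut B} (hτf : ∀ α, IsTauA B α (τf α)) : τf 0 * τf 0 = 1 := by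
  obtain ⟨he, hh, hf⟩ := hτf 0
  rw [mul_zero, zero_smul, add_zero] at hh
  rw [zero_smul, zero_pow two_ne_zero, zero_smul, add_zero, sub_zero] at hf
  refine PAut.ext_of_hf ?_ ?_
  · rw [PAut.mul_apply, hh, map_neg, hh, neg_neg]; rfl
  · rw [PAut.mul_apply, hf, he]; rfl

lemma List.mem_tail_append_singleton {α : Type*} {L : List α} {x p : α} :
    p ∈ (L ++ [x]).tail ↔ p ∈ L.tail ∨ L ≠ [] ∧ p = x := by
  cases L <;> simp

/-- `φ` is a product `α₁β₁⋯α_kβ_kα_{k+1}c` as in the statement of the decomposition theorem. -/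
def HasDecomp (τf : K → PAut B) (Δ : K[X] → PAut B) (φ : PAut B) : Prop :=
  ∃ (L : List (PAut B × PAut B)) (αl c : PAut B),
    (∀ p ∈ L, p.1 ∈ ({1} ∪ Set.range τf : Set (PAut B)) ∧
      p.2 ∈ Δ '' {q : K[X] | q.eval 0 = 0} ∧ p.2 ≠ 1) ∧
    (∀ p ∈ L.tail, p.1 ≠ 1) ∧
    αl ∈ ({1} ∪ Set.range τf : Set (PAut B)) ∧
    c ∈ CsetLT B ∧
    φ = (L.map fun p => p.1 * p.2).prod * αl * c

lemma IsLin.hasDecomp {τf : K → PAut B} (hτf : ∀ α, IsTauA B α (τf α)) {Δ : K[X] → PAut B}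
    {φ : PAut B} (hφ : IsLin φ) : HasDecomp τf Δ φ := by
  obtain ⟨α, hα, c, hc, rfl⟩ := hφ.exists_eq_mul hτf
  exact ⟨[], α, c, by simp, by simp, hα, hc, by simp⟩

lemma HasDecomp.mul_isLin {τf : K → PAut B} (hτf : ∀ α, IsTauA B α (τf α)) {Δ : K[X] → PAut B}
    {φ ψ : PAut B} (hφ : HasDecomp τf Δ φ) (hψ : IsLin ψ) : HasDecomp τf Δ (φ * ψ) := by
  obtain ⟨L, αl, c, hL, hL', hα, hc, rfl⟩ := hφ
  have hαl : IsLin αl := by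
    rcases hα with rfl | ⟨α, rfl⟩
    exacts [isLin_one, (hτf α).isLin]
  obtain ⟨α', hα', c', hc', h⟩ := ((hαl.mul (isLin_of_mem_CsetLT hc)).mul hψ).exists_eq_mul hτf
  refine ⟨L, α', c', hL, hL', hα', hc', ?_⟩
  rw [mul_assoc _ α' c', ← h]
  simp only [mul_assoc]

lemma HasDecomp.mul_delta {τf : K → PAut B} {Δ : K[X] → PAut B} (hΔ : ∀ g, IsDelta B g (Δ g))
    {φ : PAut B} (hφ : HasDecomp τf Δ φ) (g : K[X]) : HasDecomp τf Δ (φ * Δ g) := by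
  obtain ⟨L, αl, c, hL, hL', hα, hc, rfl⟩ := hφ
  obtain ⟨q, hq, c', hc', h⟩ := exists_mul_delta_eq hΔ hc g
  rw [mul_assoc _ c, h, ← mul_assoc]
  by_cases hq1 : Δ q = 1
  · exact ⟨L, αl, c', hL, hL', hα, hc', by rw [hq1, mul_one]⟩
  by_cases hend : αl ≠ 1 ∨ L = []
  · refine ⟨L ++ [(αl, Δ q)], 1, c', ?_, ?_, Or.inl rfl, hc', ?_⟩
    · simp only [List.mem_append, List.mem_singleton]
      rintro p (hp | rfl)
      exacts [hL p hp, ⟨hα, ⟨q, hq, rfl⟩, hq1⟩]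
    · intro p hp
      rcases List.mem_tail_append_singleton.mp hp with hp | ⟨hne, rfl⟩
      exacts [hL' p hp, hend.resolve_right hne]
    · simp only [List.map_append, List.map_cons, List.map_nil, List.prod_append,
        List.prod_singleton, mul_one, mul_assoc]
  push Not at hend
  obtain ⟨rfl, hne⟩ := hend
  obtain ⟨L, ⟨a, b⟩, rfl⟩ := List.eq_nil_or_concat' L |>.resolve_left hne
  obtain ⟨ha, ⟨r, hr, hrb⟩, -⟩ := hL (a, b) (by simp)
  change Δ r = b at hrb
  subst hrb
  have hL₁ := fun p hp => hL p (List.mem_append_left _ hp)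
  have hL₁' := fun p hp => hL' p (List.mem_tail_append_singleton.mpr (Or.inl hp))
  by_cases hrq : Δ (r + q) = 1
  · refine ⟨L, a, c', hL₁, hL₁', ha, hc', ?_⟩
    simp only [List.map_append, List.map_cons, List.map_nil, List.prod_append,
      List.prod_singleton, mul_one, mul_assoc]
    rw [← mul_assoc (Δ r), delta_mul hΔ, hrq, one_mul]
  · refine ⟨L ++ [(a, Δ (r + q))], 1, c', ?_, ?_, Or.inl rfl, hc', ?_⟩
    · simp only [List.mem_append, List.mem_singleton]
      rintro p (hp | rfl)
      · exact hL₁ p hp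
      · exact ⟨ha, ⟨r + q, by simpa [hq] using hr, rfl⟩, hrq⟩
    · intro p hp
      rcases List.mem_tail_append_singleton.mp hp with hp | ⟨hne, rfl⟩
      · exact hL₁' p hp
      · exact hL' (a, Δ r) (List.mem_tail_append_singleton.mpr (Or.inr ⟨hne, rfl⟩))
    · simp only [List.map_append, List.map_cons, List.map_nil, List.prod_append,
        List.prod_singleton, mul_one, mul_assoc, ← delta_mul hΔ]

lemma hasDecomp {τf : K → PAut B} (hτf : ∀ α, IsTauA B α (τf α)) {Δ : K[X] → PAut B}
    (hΔ : ∀ g, IsDelta B g (Δ g)) (φ : PAut B) : HasDecomp τf Δ φ := by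
  induction hn : deg (φ.val (ph K lam)) using Nat.strong_induction_on generalizing φ with
  | _ n ih =>
    have hsum := deg_pe_add_deg_pf φ
    have he0 := deg_map_ne_zero φ (a := pe K lam) (by rw [deg_pe]; exact one_ne_zero)
    have hf0 := deg_map_ne_zero φ (a := pf K lam) (by rw [deg_pf]; exact one_ne_zero)
    rcases le_or_gt n 1 with hn1 | hn1
    · exact (isLin_of_gens (φ := φ) (by omega) (by omega) (by omega)).hasDecomp hτf
    have key : ∀ ψ : PAut B, deg (ψ.val (ph K lam)) = n → deg (ψ.val (pf K lam)) ≤ n →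
        HasDecomp τf Δ ψ := by
      rintro ψ rfl hle
      obtain ⟨g, hg⟩ := exists_deg_delta_lt hΔ ψ hn1 hle
      have h := (ih _ hg _ rfl).mul_delta hΔ (-g)
      rwa [mul_assoc, delta_neg hΔ, mul_one] at h
    rcases le_or_gt (deg (φ.val (pf K lam))) n with hle | hlt
    · exact key φ hn hle
    obtain ⟨-, hh, hf⟩ := hτf 0
    rw [mul_zero, zero_smul, add_zero] at hh
    rw [zero_smul, zero_pow two_ne_zero, zero_smul, add_zero, sub_zero] at hf
    have h := (key (φ * τf 0) (by rw [PAut.mul_apply, hh, map_neg, deg_neg, hn])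
      (by rw [PAut.mul_apply, hf]; omega)).mul_isLin hτf (hτf 0).isLin
    rwa [mul_assoc, tau_zero_mul_self hτf, mul_one] at h

end Automorphisms

/-- Every `φ ∈ Aut(P_λ)` can be written as
`φ = α₁∘β₁∘α₂∘β₂∘⋯∘α_k∘β_k∘α_{k+1}∘c` with `α_i ∈ A₀ = {τ_α} ∪ {id}` (the interior
`α₂,…,α_k` nontrivial), `β_i ∈ B₀ = {Δ_q : q(0) = 0}` nontrivial, and `c ∈ C`.
The list `L` records the pairs `(α_i, β_i)`, `i = 1, …, k`. -/
theorem decomposition_exists (B : PoissonBr K lam)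
    (τf : K → ↥(PAut B)) (hτf : ∀ α, IsTauA B α (τf α))
    (Δ : Polynomial K → ↥(PAut B)) (hΔ : ∀ g, IsDelta B g (Δ g)) :
    ∀ φ : ↥(PAut B), ∃ (L : List (↥(PAut B) × ↥(PAut B))) (αl c : ↥(PAut B)),
      (∀ p ∈ L, p.1 ∈ ({1} ∪ Set.range τf : Set ↥(PAut B)) ∧
        p.2 ∈ Δ '' {q : Polynomial K | Polynomial.eval 0 q = 0} ∧ p.2 ≠ 1) ∧
      (∀ (i : ℕ) (hi : i + 1 < L.length), (L.get ⟨i + 1, hi⟩).1 ≠ 1) ∧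
      αl ∈ ({1} ∪ Set.range τf : Set ↥(PAut B)) ∧
      c ∈ CsetLT B ∧
      φ = (L.map fun p => p.1 * p.2).prod * αl * c := by
  intro φ
  obtain ⟨L, αl, c, hL, hL', hα, hc, h⟩ := hasDecomp hτf hΔ φ
  refine ⟨L, αl, c, hL, fun i hi => hL' _ ?_, hα, hc, h⟩
  rw [List.get_eq_getElem, ← List.getElem_tail (h := by rw [List.length_tail]; omega)]
  exact List.getElem_mem _
end
end

section
/- The decomposition of Lemma 6 is unique: if α₁∘β₁∘⋯∘α_k∘β_k∘α_{k+1}∘c = α'₁∘β'₁∘⋯∘α'_{k'}∘β'_{k'}∘α'_{k'+1}∘c', where in each product the α's lie in A₀ (with all interior α's, i.e., α₂, …, α_k and α'₂, …, α'_{k'}, different from id), the β's lie in B₀ \ {id}, and c, c' ∈ C, then k = k', α_i = α'_i, β_i = β'_i for all i, and c = c'. In particular, no product α₁∘β₁∘⋯∘α_k∘β_k∘α_{k+1}∘c with k ≥ 1, α_i ∈ A₀, α₂, …, α_k ≠ id, β_i ∈ B₀ \ {id}, c ∈ C equals the identity. -/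
noncomputable section

open scoped Pointwise

variable (K : Type*) [Field K] [IsAlgClosed K] [CharZero K] (lam : K)

variable {K lam}

open Polynomial in
/-- `p` is a `K[t]`-point of the surface whose `f`-coordinate has the largest degree `n ≥ 1`. -/
def FDominant (n : ℕ) (p : PQ K lam →ₐ[K] K[X]) : Prop :=
  1 ≤ n ∧ (p (pf K lam)).natDegree = n ∧ (p (pe K lam)).natDegree ≤ n ∧
    (p (ph K lam)).natDegree ≤ n

open Polynomial in
/-- `p` is a `K[t]`-point of the surface whose `e`-coordinate has degree `n`, strictly larger than
the degrees of the other coordinates. -/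
def EDominant (n : ℕ) (p : PQ K lam →ₐ[K] K[X]) : Prop :=
  (p (pe K lam)).natDegree = n ∧ (p (ph K lam)).natDegree < n ∧ (p (pf K lam)).natDegree < n

/-- The action of an automorphism on points, by precomposition. -/
def pointAct {B : PoissonBr K lam} {R : Type*} [CommRing R] [Algebra K R]
    (p : PQ K lam →ₐ[K] R) (φ : ↥(PAut B)) : PQ K lam →ₐ[K] R :=
  p.comp φ.val.toAlgHom

section

set_option linter.unusedSectionVars false

variable {B : PoissonBr K lam}

@[simp]
theorem pointAct_apply {R : Type*} [CommRing R] [Algebra K R] (p : PQ K lam →ₐ[K] R)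
    (φ : ↥(PAut B)) (x : PQ K lam) : pointAct p φ x = p (φ.val x) := rfl

theorem pointAct_mul {R : Type*} [CommRing R] [Algebra K R] (p : PQ K lam →ₐ[K] R)
    (φ ψ : ↥(PAut B)) : pointAct p (φ * ψ) = pointAct (pointAct p φ) ψ := rfl

theorem pointAct_one {R : Type*} [CommRing R] [Algebra K R] (p : PQ K lam →ₐ[K] R) :
    pointAct p (1 : ↥(PAut B)) = p := rfl

theorem PAut.ext_generators {φ ψ : ↥(PAut B)} (he : φ.val (pe K lam) = ψ.val (pe K lam))
    (hh : φ.val (ph K lam) = ψ.val (ph K lam)) (hf : φ.val (pf K lam) = ψ.val (pf K lam)) :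
    φ = ψ := by
  have key : φ.val.toAlgHom = ψ.val.toAlgHom := by
    apply Ideal.Quotient.algHom_ext
    apply MvPolynomial.algHom_ext
    intro i
    fin_cases i
    · exact he
    · exact hh
    · exact hf
  apply Subtype.ext
  apply AlgEquiv.ext
  intro x
  exact DFunLike.congr_fun key x

theorem IsDelta.eq_mul {g₁ g₂ : Polynomial K} {D₁ D₂ D : ↥(PAut B)} (h₁ : IsDelta B g₁ D₁)
    (h₂ : IsDelta B g₂ D₂) (h : IsDelta B (g₁ + g₂) D) : D = D₁ * D₂ := by
  obtain ⟨e₁, hh₁, f₁⟩ := h₁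
  obtain ⟨e₂, hh₂, f₂⟩ := h₂
  obtain ⟨e, hh, f⟩ := h
  have hm : ∀ x, (D₁ * D₂).val x = D₁.val (D₂.val x) := fun _ => rfl
  have ha : D₁.val (Polynomial.aeval (pf K lam) g₂) = Polynomial.aeval (pf K lam) g₂ := by
    rw [← Polynomial.aeval_algHom_apply, f₁]
  apply PAut.ext_generators
  · rw [hm, e, e₂]
    simp only [map_sub, map_mul, map_pow, map_add, ha, e₁, hh₁, f₁]
    ring
  · rw [hm, hh, hh₂]
    simp only [map_mul, map_add, map_ofNat, ha, hh₁, f₁]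
    ring
  · rw [hm, f, f₂, f₁]

theorem IsDelta.eq_one {D : ↥(PAut B)} (h : IsDelta B 0 D) : D = 1 := by
  obtain ⟨e, hh, f⟩ := h
  apply PAut.ext_generators
  · simpa using e
  · simpa using hh
  · simpa using f

theorem one_mem_CsetLT : (1 : ↥(PAut B)) ∈ CsetLT B :=
  ⟨0, 1, by simp, by simp, by simp⟩

open Polynomial

theorem FDominant.eDominant_of_pointAct_isDelta {q : K[X]} {D : ↥(PAut B)} (hD : IsDelta B q D)
    (hq0 : q.eval 0 = 0) (hq : q ≠ 0) {n : ℕ} {p : PQ K lam →ₐ[K] K[X]}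
    (hp : FDominant n (pointAct p D)) : ∃ m, 2 ≤ m ∧ EDominant m p := by
  obtain ⟨he, hh, hf⟩ := hD
  obtain ⟨hn, pF, pE, pH⟩ := hp
  simp only [pointAct_apply] at pF pE pH
  rw [hf] at pF
  rw [he] at pE
  rw [hh] at pH
  set E := p (pe K lam)
  set H := p (ph K lam)
  set F := p (pf K lam)
  set Q : K[X] := q.comp F with hQ
  have hQ' : p (aeval (pf K lam) q) = Q := by
    rw [← aeval_algHom_apply, hQ, comp_eq_aeval]
  simp only [map_sub, map_mul, map_pow, map_add, map_ofNat, hQ'] at pE pH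
  have hd : 1 ≤ q.natDegree := by
    by_contra hlt
    obtain ⟨a, ha⟩ := natDegree_eq_zero.1 (by omega : q.natDegree = 0)
    subst ha
    simp_all
  have hdQ : Q.natDegree = q.natDegree * n := by rw [hQ, natDegree_comp, pF]
  have hF0 : F ≠ 0 := by
    rintro h0
    rw [h0, natDegree_zero] at pF
    omega
  have hnd : n ≤ q.natDegree * n := Nat.le_mul_of_pos_left n hd
  have hQ0 : Q ≠ 0 := by
    rintro h0
    rw [h0, natDegree_zero] at hdQ
    omega
  have hFQ : (F * Q).natDegree = n + q.natDegree * n := by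
    rw [natDegree_mul hF0 hQ0, pF, hdQ]
  have hFQ2 : (F * Q ^ 2).natDegree = n + 2 * (q.natDegree * n) := by
    rw [natDegree_mul hF0 (pow_ne_zero _ hQ0), natDegree_pow, pF, hdQ]
  have h2 : (2 * (F * Q) : K[X]).natDegree ≤ n + q.natDegree * n := by
    rw [← hFQ, two_mul]
    exact natDegree_add_le_of_degree_le le_rfl le_rfl
  have hHb : H.natDegree ≤ n + q.natDegree * n := by
    have : H = (H + 2 * (F * Q)) - 2 * (F * Q) := by ring
    rw [this]
    exact natDegree_sub_le_of_le (by omega) h2 |>.trans (by simp)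
  set H' := H + 2 * (F * Q) with hH'
  set E' := E - Q * H - F * Q ^ 2 with hE'
  have hE : E = (E' + Q * H') - F * Q ^ 2 := by rw [hE', hH']; ring
  have hlow : (E' + Q * H').natDegree ≤ n + q.natDegree * n := by
    refine natDegree_add_le_of_degree_le (by omega) ?_
    refine natDegree_mul_le.trans ?_
    omega
  have hEd : E.natDegree = n + 2 * (q.natDegree * n) := by
    rw [hE, natDegree_sub_eq_right_of_natDegree_lt (by omega), hFQ2]
  exact ⟨n + 2 * (q.natDegree * n), by omega, hEd,
    (by omega : H.natDegree < _), (by omega : F.natDegree < _)⟩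

theorem FDominant.of_pointAct_isTauA {α : K} {D : ↥(PAut B)} (hD : IsTauA B α D)
    {n : ℕ} {p : PQ K lam →ₐ[K] K[X]} (hn : 1 ≤ n)
    (he : (pointAct p D (pe K lam)).natDegree = n)
    (hh : (pointAct p D (ph K lam)).natDegree ≤ n)
    (hf : (pointAct p D (pf K lam)).natDegree ≤ n) : FDominant n p := by
  obtain ⟨e₁, h₁, f₁⟩ := hD
  simp only [pointAct_apply, e₁, h₁, f₁, map_sub, map_add, map_neg, map_smul] at he hh hf
  set E := p (pe K lam)
  set H := p (ph K lam)
  set F := p (pf K lam)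
  have hs : ∀ (a : K) (G : K[X]), G.natDegree ≤ n → (a • G).natDegree ≤ n := fun a G hG =>
    (natDegree_smul_le a G).trans hG
  have hH : H.natDegree ≤ n := by
    have : H = (2 * α) • F - (-H + (2 * α) • F) := by ring
    rw [this]
    exact natDegree_sub_le_of_le (hs _ _ he.le) hh |>.trans (by simp)
  refine ⟨hn, he, ?_, hH⟩
  change E.natDegree ≤ n
  have : E = (E + α • H - α ^ 2 • F) + α ^ 2 • F - α • H := by ring
  rw [this]
  exact natDegree_sub_le_of_le (natDegree_add_le_of_degree_le hf (hs _ _ he.le)) (hs _ _ hH)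
    |>.trans (by simp)

theorem IsTauA.not_eDominant {α : K} {D : ↥(PAut B)} (hD : IsTauA B α D) {m n : ℕ}
    {p : PQ K lam →ₐ[K] K[X]} (hp : EDominant n p) : ¬ EDominant m (pointAct p D) := by
  intro hm
  obtain ⟨e₀, h₀, f₀⟩ := hp
  have hF := FDominant.of_pointAct_isTauA hD (by have := hm.2.1; omega) hm.1
    hm.2.1.le hm.2.2.le
  obtain ⟨-, hf, he, -⟩ := hF
  omega

theorem IsTauA.param_eq_of_eDominant {α α' : K} {D D' : ↥(PAut B)} (hD : IsTauA B α D)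
    (hD' : IsTauA B α' D') {m n : ℕ} {p : PQ K lam →ₐ[K] K[X]}
    (hp : EDominant n (pointAct p D)) (hp' : EDominant m (pointAct p D')) : α = α' := by
  obtain ⟨e₁, h₁, -⟩ := hD
  obtain ⟨e₂, h₂, -⟩ := hD'
  obtain ⟨he, hh, -⟩ := hp
  obtain ⟨he', hh', -⟩ := hp'
  simp only [pointAct_apply, e₁, h₁, e₂, h₂, map_add, map_neg, map_smul] at he hh he' hh'
  by_contra hne
  have hc : 2 * (α - α') ≠ 0 := mul_ne_zero two_ne_zero (sub_ne_zero.2 hne)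
  have hd := natDegree_smul_of_smul_regular (p := p (pf K lam)) (IsSMulRegular.of_ne_zero hc)
  have hsub : (2 * (α - α')) • p (pf K lam) =
      (-p (ph K lam) + (2 * α) • p (pf K lam)) - (-p (ph K lam) + (2 * α') • p (pf K lam)) := by
    rw [mul_sub, sub_smul]; ring
  have hle := natDegree_sub_le_of_le (Nat.le_sub_one_of_lt hh)
    (Nat.le_sub_one_of_lt (he'.symm.trans he ▸ hh' :
      (-p (ph K lam) + (2 * α') • p (pf K lam)).natDegree < n))
  rw [← hsub, hd, he, max_self] at hle
  omega

/-- A point `r` is generic for `c` when every point moved to `r` by `α * c`, with `α` in the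
transversal `A₀`, is `f`-dominant of degree one. -/
def GenericFor (τf : K → ↥(PAut B)) (r : PQ K lam →ₐ[K] K[X]) (c : ↥(PAut B)) : Prop :=
  ∀ α ∈ ({1} ∪ Set.range τf : Set ↥(PAut B)), ∀ p, pointAct p (α * c) = r → FDominant 1 p

theorem exists_linear_point (a s : K) (hs : s ^ 2 = lam) :
    ∃ r : PQ K lam →ₐ[K] K[X], r (pe K lam) = -C (a * s) - C (a ^ 2) * X ∧
      r (ph K lam) = C s + C (2 * a) * X ∧ r (pf K lam) = X := by
  let v : Fin 3 → K[X] := ![-C (a * s) - C (a ^ 2) * X, C s + C (2 * a) * X, X]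
  have hv₀ : v 0 = -C (a * s) - C (a ^ 2) * X := rfl
  have hv₁ : v 1 = C s + C (2 * a) * X := rfl
  have hv₂ : v 2 = X := rfl
  refine ⟨Ideal.Quotient.liftₐ _ (MvPolynomial.aeval v) ?_, ?_, ?_, ?_⟩
  · intro x hx
    refine (Ideal.span_le (I := RingHom.ker (MvPolynomial.aeval (R := K) v))).2 ?_ hx
    rintro _ rfl
    simp only [SetLike.mem_coe, RingHom.mem_ker, map_sub, map_add, map_mul, map_pow,
      MvPolynomial.aeval_X, map_ofNat, MvPolynomial.aeval_C, hv₀, hv₁, hv₂, ← hs, algebraMap_eq]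
    ring
  · exact MvPolynomial.aeval_X v 0
  · exact MvPolynomial.aeval_X v 1
  · exact MvPolynomial.aeval_X v 2

theorem genericFor_of_linear {τf : K → ↥(PAut B)} (hτf : ∀ α, IsTauA B α (τf α)) {a s γ : K}
    {β : Kˣ} (ha : a + γ ≠ 0) {c : ↥(PAut B)}
    (ce : c.val (pe K lam) =
      (β : K) • pe K lam + γ • ph K lam - (γ ^ 2 / (β : K)) • pf K lam)
    (ch : c.val (ph K lam) = ph K lam - (2 * γ / (β : K)) • pf K lam)
    (cf : c.val (pf K lam) = (β : K)⁻¹ • pf K lam)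
    {r : PQ K lam →ₐ[K] K[X]} (re : r (pe K lam) = -C (a * s) - C (a ^ 2) * X)
    (rh : r (ph K lam) = C s + C (2 * a) * X) (rf : r (pf K lam) = X) :
    GenericFor τf r c := by
  intro α hα p hp
  rw [pointAct_mul] at hp
  generalize hu : pointAct p α = u at hp
  have hb : (β : K) ≠ 0 := β.ne_zero
  have hbb : C (β : K) * C (β : K)⁻¹ = 1 := by rw [← C_mul, mul_inv_cancel₀ hb, C_1]
  rw [← hp] at re rh rf
  simp only [pointAct_apply, ce, ch, cf, map_sub, map_add, map_smul, smul_eq_C_mul] at re rh rf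
  have uf : u (pf K lam) = C (β : K) * X + C 0 := by
    rw [← rf, ← mul_assoc, hbb]; simp
  have uh : u (ph K lam) = C (2 * (a + γ)) * X + C s := by
    rw [uf] at rh
    simp only [div_eq_mul_inv, map_mul, map_add, map_ofNat, map_zero] at rh ⊢
    linear_combination rh + 2 * C γ * X * hbb
  have ue : u (pe K lam) =
      C (-((β : K)⁻¹ * (a + γ) ^ 2)) * X + C (-((β : K)⁻¹ * ((a + γ) * s))) := by
    rw [uf, uh] at re
    simp only [div_eq_mul_inv, map_mul, map_add, map_neg, map_pow, map_ofNat, map_zero] at re ⊢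
    linear_combination C (β : K)⁻¹ * re +
      (C γ ^ 2 * C (β : K)⁻¹ * X - u (pe K lam)) * hbb
  rcases hα with rfl | ⟨δ, rfl⟩
  · rw [pointAct_one] at hu
    subst hu
    exact ⟨le_rfl, by rw [uf]; exact natDegree_linear hb, by rw [ue]; exact natDegree_linear_le,
      by rw [uh]; exact natDegree_linear_le⟩
  · refine FDominant.of_pointAct_isTauA (hτf δ) le_rfl ?_ ?_ ?_
    · rw [hu, ue]
      exact natDegree_linear (neg_ne_zero.2 (mul_ne_zero (inv_ne_zero hb) (pow_ne_zero _ ha)))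
    · rw [hu, uh]; exact natDegree_linear_le
    · rw [hu, uf]; exact natDegree_linear_le

theorem exists_genericFor_pair {τf : K → ↥(PAut B)} (hτf : ∀ α, IsTauA B α (τf α))
    {c c' : ↥(PAut B)} (hc : c ∈ CsetLT B) (hc' : c' ∈ CsetLT B) :
    ∃ r, GenericFor τf r c ∧ GenericFor τf r c' := by
  obtain ⟨γ, β, ce, ch, cf⟩ := hc
  obtain ⟨γ', β', ce', ch', cf'⟩ := hc'
  classical
  obtain ⟨a, ha⟩ := Infinite.exists_notMem_finset ({-γ, -γ'} : Finset K)
  obtain ⟨s, hs⟩ := IsAlgClosed.exists_pow_nat_eq lam (n := 2) two_pos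
  obtain ⟨r, re, rh, rf⟩ := exists_linear_point (lam := lam) a s hs
  simp only [Finset.mem_insert, Finset.mem_singleton, not_or, ← add_eq_zero_iff_eq_neg] at ha
  exact ⟨r, genericFor_of_linear hτf ha.1 ce ch cf re rh rf,
    genericFor_of_linear hτf ha.2 ce' ch' cf' re rh rf⟩

/-- The list `L` of pairs `(α_i, β_i)` has entries in `A₀ × (B₀ \ {id})` and its interior `α`'s
are nontrivial. -/
def IsReducedList (τf : K → ↥(PAut B)) (Δ : K[X] → ↥(PAut B))
    (L : List (↥(PAut B) × ↥(PAut B))) : Prop :=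
  (∀ p ∈ L, p.1 ∈ ({1} ∪ Set.range τf : Set ↥(PAut B)) ∧
    p.2 ∈ Δ '' {q : K[X] | q.eval 0 = 0} ∧ p.2 ≠ 1) ∧ ∀ p ∈ L.tail, p.1 ≠ 1

/-- The product `α₁∘β₁∘⋯∘α_k∘β_k` of a list of pairs `(α_i, β_i)`. -/
def pairProd (L : List (↥(PAut B) × ↥(PAut B))) : ↥(PAut B) := (L.map fun p => p.1 * p.2).prod

theorem pairProd_cons (x : ↥(PAut B) × ↥(PAut B)) (L : List (↥(PAut B) × ↥(PAut B))) :
    pairProd (x :: L) = x.1 * x.2 * pairProd L := by simp [pairProd]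

theorem pairProd_nil : pairProd ([] : List (↥(PAut B) × ↥(PAut B))) = 1 := rfl

theorem isReducedList_of_get {τf : K → ↥(PAut B)} {Δ : K[X] → ↥(PAut B)}
    {L : List (↥(PAut B) × ↥(PAut B))}
    (h : ∀ p ∈ L, p.1 ∈ ({1} ∪ Set.range τf : Set ↥(PAut B)) ∧
      p.2 ∈ Δ '' {q : K[X] | q.eval 0 = 0} ∧ p.2 ≠ 1)
    (hi : ∀ (i : ℕ) (hi : i + 1 < L.length), (L.get ⟨i + 1, hi⟩).1 ≠ 1) :
    IsReducedList τf Δ L := by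
  refine ⟨h, fun p hp => ?_⟩
  cases L with
  | nil => simp at hp
  | cons x L =>
    obtain ⟨i, hlt, rfl⟩ := List.mem_iff_getElem.1 hp
    exact hi i (by simpa using hlt)

section Words

variable {τf : K → ↥(PAut B)} {Δ : K[X] → ↥(PAut B)}

theorem IsReducedList.of_cons {x : ↥(PAut B) × ↥(PAut B)} {L : List (↥(PAut B) × ↥(PAut B))}
    (h : IsReducedList τf Δ (x :: L)) : IsReducedList τf Δ L :=
  ⟨fun p hp => h.1 p (List.mem_cons_of_mem _ hp), fun p hp => h.2 p (List.mem_of_mem_tail hp)⟩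

theorem GenericFor.exists_eDominant (hτf : ∀ α, IsTauA B α (τf α))
    (hΔ : ∀ g, IsDelta B g (Δ g)) {αl c : ↥(PAut B)}
    (hαl : αl ∈ ({1} ∪ Set.range τf : Set ↥(PAut B))) {r : PQ K lam →ₐ[K] K[X]}
    (hr : GenericFor τf r c) {L : List (↥(PAut B) × ↥(PAut B))} {x : ↥(PAut B) × ↥(PAut B)}
    (hL : IsReducedList τf Δ (x :: L)) {p : PQ K lam →ₐ[K] K[X]}
    (hp : pointAct p (pairProd (x :: L) * αl * c) = r) :
    ∃ n, 2 ≤ n ∧ EDominant n (pointAct p x.1) := by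
  induction L generalizing x p with
  | nil =>
    obtain ⟨-, ⟨q, hq0, hq⟩, hne⟩ := hL.1 x (by simp)
    have hF := hr αl hαl (pointAct (pointAct p x.1) x.2) (by
      rw [← hp, pairProd_cons, pairProd_nil, mul_one]; rfl)
    refine FDominant.eDominant_of_pointAct_isDelta (hq ▸ hΔ q) hq0 ?_ hF
    rintro rfl
    exact hne (hq ▸ (hΔ 0).eq_one)
  | cons y L ih =>
    obtain ⟨-, ⟨q, hq0, hq⟩, hne⟩ := hL.1 x (by simp)
    obtain ⟨n, hn, hE⟩ := ih hL.of_cons (p := pointAct (pointAct p x.1) x.2) (by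
      rw [← hp, pairProd_cons x]; rfl)
    have hy1 : y.1 ≠ 1 := hL.2 y (by simp)
    obtain ⟨δ, hδ⟩ := (hL.of_cons.1 y (by simp)).1.resolve_left hy1
    have hF := FDominant.of_pointAct_isTauA (hδ ▸ hτf δ) (by omega) hE.1 hE.2.1.le
      hE.2.2.le
    refine FDominant.eDominant_of_pointAct_isDelta (hq ▸ hΔ q) hq0 ?_ hF
    rintro rfl
    exact hne (hq ▸ (hΔ 0).eq_one)

theorem exists_pointAct_eq (r : PQ K lam →ₐ[K] K[X]) (φ : ↥(PAut B)) :
    ∃ p, pointAct p φ = r :=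
  ⟨pointAct r φ⁻¹, by rw [← pointAct_mul, inv_mul_cancel, pointAct_one]⟩

theorem IsReducedList.pairProd_cons_ne (hτf : ∀ α, IsTauA B α (τf α))
    (hΔ : ∀ g, IsDelta B g (Δ g)) {αl αl' c c' : ↥(PAut B)}
    (hαl : αl ∈ ({1} ∪ Set.range τf : Set ↥(PAut B)))
    (hαl' : αl' ∈ ({1} ∪ Set.range τf : Set ↥(PAut B)))
    (hc : c ∈ CsetLT B) (hc' : c' ∈ CsetLT B)
    {L : List (↥(PAut B) × ↥(PAut B))} {x : ↥(PAut B) × ↥(PAut B)}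
    (hL : IsReducedList τf Δ (x :: L)) : pairProd (x :: L) * αl * c ≠ αl' * c' := by
  intro h
  obtain ⟨r, hr, hr'⟩ := exists_genericFor_pair hτf hc hc'
  obtain ⟨p, hp⟩ := exists_pointAct_eq r (αl' * c')
  obtain ⟨-, hf, he, -⟩ := hr' αl' hαl' p hp
  obtain ⟨n, hn, hE, -⟩ := hr.exists_eDominant hτf hΔ hαl hL (h ▸ hp)
  rcases (hL.1 x (by simp)).1 with h1 | ⟨δ, hδ⟩
  · rw [Set.mem_singleton_iff.1 h1, pointAct_one] at hE
    omega
  · rw [← hδ, pointAct_apply, (hτf δ).1] at hE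
    omega

theorem IsReducedList.head_fst_eq (hτf : ∀ α, IsTauA B α (τf α))
    (hΔ : ∀ g, IsDelta B g (Δ g)) {αl αl' c c' : ↥(PAut B)}
    (hαl : αl ∈ ({1} ∪ Set.range τf : Set ↥(PAut B)))
    (hαl' : αl' ∈ ({1} ∪ Set.range τf : Set ↥(PAut B)))
    (hc : c ∈ CsetLT B) (hc' : c' ∈ CsetLT B)
    {L L' : List (↥(PAut B) × ↥(PAut B))} {x x' : ↥(PAut B) × ↥(PAut B)}
    (hL : IsReducedList τf Δ (x :: L)) (hL' : IsReducedList τf Δ (x' :: L'))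
    (h : pairProd (x :: L) * αl * c = pairProd (x' :: L') * αl' * c') : x.1 = x'.1 := by
  obtain ⟨r, hr, hr'⟩ := exists_genericFor_pair hτf hc hc'
  obtain ⟨p, hp⟩ := exists_pointAct_eq r (pairProd (x :: L) * αl * c)
  obtain ⟨n, -, hE⟩ := hr.exists_eDominant hτf hΔ hαl hL hp
  obtain ⟨m, -, hE'⟩ := hr'.exists_eDominant hτf hΔ hαl' hL' (h ▸ hp)
  rcases (hL.1 x (by simp)).1 with h1 | ⟨δ, hδ⟩ <;>
    rcases (hL'.1 x' (by simp)).1 with h1' | ⟨δ', hδ'⟩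
  · exact h1.trans h1'.symm
  · rw [Set.mem_singleton_iff.1 h1, pointAct_one] at hE
    exact absurd (hδ' ▸ hE') ((hτf δ').not_eDominant hE)
  · rw [Set.mem_singleton_iff.1 h1', pointAct_one] at hE'
    exact absurd (hδ ▸ hE) ((hτf δ).not_eDominant hE')
  · rw [← hδ, ← hδ', (hτf δ).param_eq_of_eDominant (hτf δ') (hδ ▸ hE) (hδ' ▸ hE')]

theorem IsReducedList.head_snd_eq (hτf : ∀ α, IsTauA B α (τf α))
    (hΔ : ∀ g, IsDelta B g (Δ g)) {αl αl' c c' : ↥(PAut B)}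
    (hαl : αl ∈ ({1} ∪ Set.range τf : Set ↥(PAut B)))
    (hαl' : αl' ∈ ({1} ∪ Set.range τf : Set ↥(PAut B)))
    (hc : c ∈ CsetLT B) (hc' : c' ∈ CsetLT B)
    {L L' : List (↥(PAut B) × ↥(PAut B))} {x x' : ↥(PAut B) × ↥(PAut B)}
    (hL : IsReducedList τf Δ (x :: L)) (hL' : IsReducedList τf Δ (x' :: L'))
    (h : x.2 * (pairProd L * αl * c) = x'.2 * (pairProd L' * αl' * c')) : x.2 = x'.2 := by
  obtain ⟨-, ⟨q, hq0, hq⟩, -⟩ := hL.1 x (by simp)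
  obtain ⟨-, ⟨q', hq0', hq'⟩, -⟩ := hL'.1 x' (by simp)
  have hdiff : x.2 = x'.2 * Δ (q - q') := by
    rw [← hq, ← hq']
    exact (hΔ q').eq_mul (hΔ (q - q')) (by rw [add_sub_cancel]; exact hΔ q)
  by_contra hne
  have hne1 : Δ (q - q') ≠ 1 := fun h1 => hne (by rw [hdiff, h1, mul_one])
  have hred : IsReducedList τf Δ ((1, Δ (q - q')) :: L) := by
    refine ⟨fun p hp => ?_, hL.2⟩
    rcases List.mem_cons.1 hp with rfl | hp
    · refine ⟨Or.inl rfl, ⟨q - q', ?_, rfl⟩, hne1⟩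
      have h0 : q.eval 0 = 0 := hq0
      have h0' : q'.eval 0 = 0 := hq0'
      simp [h0, h0']
    · exact hL.of_cons.1 p hp
  rw [hdiff] at h
  replace h := mul_left_cancel ((mul_assoc _ _ _).symm.trans h)
  have h' : pairProd ((1, Δ (q - q')) :: L) * αl * c = pairProd L' * αl' * c' := by
    rw [← h, pairProd_cons, one_mul]
    simp only [mul_assoc]
  cases L' with
  | nil =>
    rw [pairProd_nil, one_mul] at h'
    exact hred.pairProd_cons_ne hτf hΔ hαl hαl' hc hc' h'
  | cons y L' =>
    exact hL'.2 y (by simp) (hred.head_fst_eq hτf hΔ hαl hαl' hc hc' hL'.of_cons h').symm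

theorem apply_pf_eq_zero_of_mul_eq {φ φ' c c' : ↥(PAut B)} (hc : c ∈ CsetLT B)
    (hc' : c' ∈ CsetLT B) (h : φ * c = φ' * c') {R : Type*} [CommRing R] [Algebra K R]
    {p : PQ K lam →ₐ[K] R} (hp : p (φ.val (pf K lam)) = 0) : p (φ'.val (pf K lam)) = 0 := by
  obtain ⟨-, β, -, -, cf⟩ := hc
  obtain ⟨-, β', -, -, cf'⟩ := hc'
  have h₁ : φ.val (c.val (pf K lam)) = φ'.val (c'.val (pf K lam)) :=
    congrArg (fun ψ : ↥(PAut B) => ψ.val (pf K lam)) h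
  replace h₁ := congrArg p h₁
  rw [cf, cf', map_smul, map_smul, map_smul, map_smul, hp, smul_zero] at h₁
  exact (smul_eq_zero_iff_eq (β'⁻¹ : Kˣ)).1 (by rw [Units.smul_def, Units.val_inv_eq_inv_val, ← h₁])

theorem IsTauA.eq_of_mul_eq (hτf : ∀ α, IsTauA B α (τf α)) {δ : K} {φ c c' : ↥(PAut B)}
    (hφ : φ ∈ ({1} ∪ Set.range τf : Set ↥(PAut B)))
    (hc : c ∈ CsetLT B) (hc' : c' ∈ CsetLT B) (h : τf δ * c = φ * c') : τf δ = φ := by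
  obtain ⟨s, hs⟩ := IsAlgClosed.exists_pow_nat_eq lam (n := 2) two_pos
  obtain ⟨r, re, rh, rf⟩ := exists_linear_point (lam := lam) δ s hs
  have hτ : ∀ α, r ((τf α).val (pf K lam)) =
      C (-(δ - α) ^ 2) * X + C ((α - δ) * s) := fun α => by
    rw [(hτf α).2.2]
    simp only [map_sub, map_add, map_smul, smul_eq_C_mul, re, rh, rf, map_mul, map_neg, map_pow,
      map_ofNat]
    ring
  have h0 := apply_pf_eq_zero_of_mul_eq hc hc' h (p := r) (by rw [hτ]; simp)
  rcases hφ with rfl | ⟨α, rfl⟩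
  · exact absurd (rf.symm.trans h0) X_ne_zero
  · rw [hτ] at h0
    have h1 := congrArg (coeff · 1) h0
    simp only [coeff_add, coeff_C_mul, coeff_X_one, coeff_C_succ, mul_one, add_zero, coeff_zero,
      neg_eq_zero] at h1
    rw [sub_eq_zero.1 (pow_eq_zero_iff two_ne_zero |>.1 h1)]

theorem eq_of_mul_mem_CsetLT_eq (hτf : ∀ α, IsTauA B α (τf α)) {αl αl' c c' : ↥(PAut B)}
    (hαl : αl ∈ ({1} ∪ Set.range τf : Set ↥(PAut B)))
    (hαl' : αl' ∈ ({1} ∪ Set.range τf : Set ↥(PAut B)))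
    (hc : c ∈ CsetLT B) (hc' : c' ∈ CsetLT B) (h : αl * c = αl' * c') : αl = αl' := by
  rcases hαl with h1 | ⟨δ, rfl⟩
  · rcases hαl' with h1' | ⟨δ', rfl⟩
    · exact h1.trans h1'.symm
    · exact (IsTauA.eq_of_mul_eq hτf (Or.inl h1) hc' hc h.symm).symm
  · exact IsTauA.eq_of_mul_eq hτf hαl' hc hc' h

theorem IsReducedList.unique (hτf : ∀ α, IsTauA B α (τf α))
    (hΔ : ∀ g, IsDelta B g (Δ g)) {αl αl' c c' : ↥(PAut B)}
    (hαl : αl ∈ ({1} ∪ Set.range τf : Set ↥(PAut B)))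
    (hαl' : αl' ∈ ({1} ∪ Set.range τf : Set ↥(PAut B)))
    (hc : c ∈ CsetLT B) (hc' : c' ∈ CsetLT B)
    {L L' : List (↥(PAut B) × ↥(PAut B))}
    (hL : IsReducedList τf Δ L) (hL' : IsReducedList τf Δ L')
    (h : pairProd L * αl * c = pairProd L' * αl' * c') : L = L' ∧ αl = αl' ∧ c = c' := by
  induction L generalizing L' with
  | nil =>
    cases L' with
    | nil =>
      rw [pairProd_nil, one_mul, one_mul] at h
      obtain rfl := eq_of_mul_mem_CsetLT_eq hτf hαl hαl' hc hc' h
      exact ⟨rfl, rfl, mul_left_cancel h⟩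
    | cons x' L' =>
      rw [pairProd_nil, one_mul] at h
      exact absurd h.symm (hL'.pairProd_cons_ne hτf hΔ hαl' hαl hc' hc)
  | cons x L ih =>
    cases L' with
    | nil =>
      rw [pairProd_nil, one_mul] at h
      exact absurd h (hL.pairProd_cons_ne hτf hΔ hαl hαl' hc hc')
    | cons x' L' =>
      have h₁ := hL.head_fst_eq hτf hΔ hαl hαl' hc hc' hL' h
      simp only [pairProd_cons, h₁, mul_assoc, mul_left_cancel_iff] at h
      simp only [← mul_assoc (pairProd _)] at h
      have h₂ := hL.head_snd_eq hτf hΔ hαl hαl' hc hc' hL' h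
      rw [h₂, mul_left_cancel_iff] at h
      obtain ⟨rfl, hα, hcc⟩ := ih hL.of_cons hL'.of_cons h
      exact ⟨by rw [Prod.ext h₁ h₂], hα, hcc⟩

end Words

end

/-- The decomposition `φ = α₁∘β₁∘⋯∘α_k∘β_k∘α_{k+1}∘c` (with `α_i ∈ A₀`,
interior `α`'s nontrivial, `β_i ∈ B₀ \ {id}`, `c ∈ C`) is unique; in particular no such
product with `k ≥ 1` equals the identity. The lists record the pairs `(α_i, β_i)`. -/
theorem decomposition_unique (B : PoissonBr K lam)
    (τf : K → ↥(PAut B)) (hτf : ∀ α, IsTauA B α (τf α))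
    (Δ : Polynomial K → ↥(PAut B)) (hΔ : ∀ g, IsDelta B g (Δ g)) :
    (∀ (L L' : List (↥(PAut B) × ↥(PAut B))) (αl αl' c c' : ↥(PAut B)),
      (∀ p ∈ L, p.1 ∈ ({1} ∪ Set.range τf : Set ↥(PAut B)) ∧
        p.2 ∈ Δ '' {q : Polynomial K | Polynomial.eval 0 q = 0} ∧ p.2 ≠ 1) →
      (∀ (i : ℕ) (hi : i + 1 < L.length), (L.get ⟨i + 1, hi⟩).1 ≠ 1) →
      αl ∈ ({1} ∪ Set.range τf : Set ↥(PAut B)) → c ∈ CsetLT B →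
      (∀ p ∈ L', p.1 ∈ ({1} ∪ Set.range τf : Set ↥(PAut B)) ∧
        p.2 ∈ Δ '' {q : Polynomial K | Polynomial.eval 0 q = 0} ∧ p.2 ≠ 1) →
      (∀ (i : ℕ) (hi : i + 1 < L'.length), (L'.get ⟨i + 1, hi⟩).1 ≠ 1) →
      αl' ∈ ({1} ∪ Set.range τf : Set ↥(PAut B)) → c' ∈ CsetLT B →
      (L.map fun p => p.1 * p.2).prod * αl * c = (L'.map fun p => p.1 * p.2).prod * αl' * c' →
      L = L' ∧ αl = αl' ∧ c = c') ∧
    (∀ (L : List (↥(PAut B) × ↥(PAut B))) (αl c : ↥(PAut B)),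
      (∀ p ∈ L, p.1 ∈ ({1} ∪ Set.range τf : Set ↥(PAut B)) ∧
        p.2 ∈ Δ '' {q : Polynomial K | Polynomial.eval 0 q = 0} ∧ p.2 ≠ 1) →
      (∀ (i : ℕ) (hi : i + 1 < L.length), (L.get ⟨i + 1, hi⟩).1 ≠ 1) →
      αl ∈ ({1} ∪ Set.range τf : Set ↥(PAut B)) → c ∈ CsetLT B →
      L ≠ [] →
      (L.map fun p => p.1 * p.2).prod * αl * c ≠ 1) := by
  refine ⟨fun L L' αl αl' c c' hL hi hαl hc hL' hi' hαl' hc' h =>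
    (isReducedList_of_get hL hi).unique hτf hΔ hαl hαl' hc hc' (isReducedList_of_get hL' hi') h,
    fun L αl c hL hi hαl hc hne h => hne ?_⟩
  exact ((isReducedList_of_get hL hi).unique hτf hΔ hαl (Or.inl rfl) hc one_mem_CsetLT
    (L' := []) ⟨by simp, by simp⟩ (by rw [pairProd_nil, one_mul, one_mul]; exact h)).1
end
end
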